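/- arXiv:2406.08104 — 3 statements merged into one kernel-verified Lean document; each statement's English description precedes it below -/
import Mathlib

section
/- Let G be a DAG on unit-time jobs J, with critical path P, and m*, m*_P the maximum matching sizes in the independence graph and the bipartite independence graph respectively. The optimal value F*(M) of the resource-leveling objective with level L = 2 under makespan deadline M equals: 2(M − |P|) + |P| + m*_P for |P| ≤ M ≤ |P| + m* − m*_P; M + m* for |P| + m* − m*_P ≤ M ≤ |J| − m*; and |J| for M ≥ |J| − m*. -/
open Finset

variable {ι : Type*}

/-- Two jobs are independent (incomparable) in the precedence order. -/
def IndepJobs (prec : ι → ι → Prop) (i j : ι) : Prop :=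
  i ≠ j ∧ ¬ prec i j ∧ ¬ prec j i

/-- A matching for a relation `R`: a finite set of `R`-related pairs with
pairwise distinct endpoints. -/
def IsMatching (R : ι → ι → Prop) (pairs : Finset (ι × ι)) : Prop :=
  (∀ e ∈ pairs, R e.1 e.2) ∧
  ∀ e ∈ pairs, ∀ f ∈ pairs, e ≠ f →
    e.1 ≠ f.1 ∧ e.1 ≠ f.2 ∧ e.2 ≠ f.1 ∧ e.2 ≠ f.2

/-- `m` is the maximum size of a matching for relation `R`. -/
def IsMaxMatchingSize (R : ι → ι → Prop) (m : ℕ) : Prop :=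
  (∃ pairs : Finset (ι × ι), IsMatching R pairs ∧ pairs.card = m) ∧
  ∀ pairs : Finset (ι × ι), IsMatching R pairs → pairs.card ≤ m

/-- A critical path: a longest directed path (nodup chain) of the precedence DAG. -/
def IsCriticalPath (prec : ι → ι → Prop) (P : List ι) : Prop :=
  P.Chain' prec ∧ P.Nodup ∧
  ∀ Q : List ι, Q.Chain' prec → Q.Nodup → Q.length ≤ P.length

variable [Fintype ι] [DecidableEq ι]

/-- Number of (unit) jobs scheduled at time step `τ`. -/
def loadAt (x : ι → ℕ) (τ : ℕ) : ℕ := (univ.filter fun i => x i = τ).card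

/-- The resource leveling objective: per time step, resource use capped at level `L`. -/
def Fobj (L M : ℕ) (x : ι → ℕ) : ℕ := ∑ τ ∈ Finset.range M, min L (loadAt x τ)

/-- Objective values of feasible schedules with makespan at most `M`. -/
def schedVals [Fintype ι] [DecidableEq ι] (prec : ι → ι → Prop) (M : ℕ) : Set ℕ :=
  {v | ∃ x : ι → ℕ, (∀ i j, prec i j → x i + 1 ≤ x j) ∧ (∀ i, x i + 1 ≤ M) ∧ Fobj 2 M x = v}

namespace RL

variable {α : Type*}

def IsCh (prec : α → α → Prop) (V : Finset α) (L : ℕ) (p : ℕ → α) : Prop :=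
  (∀ i, i < L → p i ∈ V) ∧ ∀ i j, i < j → j < L → prec (p i) (p j)

/-- matchings on `V` encoded as involutions -/
def IsM (prec : α → α → Prop) (V : Finset α) (ν : α → α) : Prop :=
  (∀ v, ν (ν v) = v) ∧ ∀ v, ν v ≠ v → v ∈ V ∧ IndepJobs prec v (ν v)

def supp [Fintype α] [DecidableEq α] (ν : α → α) : Finset α := univ.filter (fun v => ν v ≠ v)

def unc [DecidableEq α] (ν : α → α) (p : ℕ → α) (L : ℕ) : ℕ :=
  ((range L).filter (fun i => ν (p i) = p i)).card

def FV (V : Finset α) (M : ℕ) (x : α → ℕ) : ℕ :=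
  ∑ τ ∈ range M, min 2 (V.filter (fun i => x i = τ)).card

def Sch (prec : α → α → Prop) (V : Finset α) (M : ℕ) (x : α → ℕ) : Prop :=
  (∀ i ∈ V, ∀ j ∈ V, prec i j → x i < x j) ∧ ∀ i ∈ V, x i < M

def Good (prec : α → α → Prop) (V : Finset α) (s u : ℕ) : Prop :=
  ∃ M x, Sch prec V M x ∧ 2 * M ≤ s + 2 * u ∧ 2 * M + s ≤ 2 * FV V M x

def Src (prec : α → α → Prop) (V : Finset α) (v : α) : Prop :=
  v ∈ V ∧ ∀ w ∈ V, ¬ prec w v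

theorem Good.mono {prec : α → α → Prop} {V : Finset α} {s u s' u' : ℕ}
    (h : Good prec V s' u') (h1 : s ≤ s') (h2 : s' + 2 * u' ≤ s + 2 * u) : Good prec V s u := by
  obtain ⟨M, x, hx, a, b⟩ := h
  exact ⟨M, x, hx, by omega, by omega⟩

theorem indep_symm {prec : α → α → Prop} {a b : α} (h : IndepJobs prec a b) :
    IndepJobs prec b a := ⟨h.1.symm, h.2.2, h.2.1⟩

/-- adding a first block -/
theorem step_block [DecidableEq α] {prec : α → α → Prop} {V B : Finset α}
    (hB : ∀ b ∈ B, Src prec V b) {M : ℕ} {x : α → ℕ}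
    (hx : Sch prec (V \ B) M x) :
    ∃ x', Sch prec V (M + 1) x' ∧ FV V (M + 1) x' = FV (V \ B) M x + min 2 B.card := by
  refine ⟨fun i => if i ∈ B then 0 else x i + 1, ⟨?_, ?_⟩, ?_⟩
  · intro i hi j hj hij
    have hjB : j ∉ B := fun h => (hB j h).2 i hi hij
    by_cases hiB : i ∈ B
    · simp [hiB, hjB]
    · have := hx.1 i (by simp [hi, hiB]) j (by simp [hj, hjB]) hij
      simp [hiB, hjB, this]
  · intro i hi
    by_cases hiB : i ∈ B
    · simp [hiB]
    · have := hx.2 i (by simp [hi, hiB])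
      simp [hiB, this]
  · unfold FV
    rw [Finset.sum_range_succ']
    congr 1
    · apply Finset.sum_congr rfl
      intro τ _
      congr 2
      ext i
      simp only [mem_filter, mem_sdiff]
      by_cases hiB : i ∈ B <;> simp [hiB]
    · congr 2
      ext i
      simp only [mem_filter]
      by_cases hiB : i ∈ B
      · simp [hiB, (hB i hiB).1]
      · simp [hiB]

def glue [DecidableEq α] (ν τ : α → α) (K : Finset α) (v : α) : α :=
  if v ∈ K then τ v else if ν v ∈ K then v else ν v

theorem glue_isM [DecidableEq α] {prec : α → α → Prop} {V K : Finset α} {ν τ : α → α}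
    (h : IsM prec V ν)
    (hτ : ∀ v ∈ K, τ v ∈ K ∧ τ (τ v) = v ∧ (τ v ≠ v → v ∈ V ∧ IndepJobs prec v (τ v))) :
    IsM prec V (glue ν τ K) := by
  obtain ⟨h1, h2⟩ := h
  constructor
  · intro v
    have := h1 v
    have := hτ v
    unfold glue
    grind
  · intro v
    have := hτ v
    have := h2 v
    unfold glue
    grind

/-- remove the pair containing `a` -/
theorem del_pair [Fintype α] [DecidableEq α] {prec : α → α → Prop} {V : Finset α} {ν : α → α}
    (h : IsM prec V ν) {a b : α} (hab : ν a = b) (hne : a ≠ b) (B : Finset α) (haB : a ∈ B)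
    (hbB : b ∈ B) (hB : ∀ v ∈ B, v ≠ a → v ≠ b → ν v = v) :
    ∃ ν', IsM prec (V \ B) ν' ∧ (∀ v, v ≠ a → v ≠ b → ν' v = ν v) ∧
      (supp ν').card + 2 = (supp ν).card := by
  have hba : ν b = a := by rw [← hab, h.1]
  have hM : IsM prec V (glue ν id {a, b}) := glue_isM h (by intro v hv; simp [hv])
  have key : ∀ v, v ≠ a → v ≠ b → glue ν id {a, b} v = ν v := by
    intro v h1 h2
    have := h.1 v
    unfold glue
    simp only [mem_insert, mem_singleton]
    grind
  have ka : glue ν id {a, b} a = a := by simp [glue]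
  have kb : glue ν id {a, b} b = b := by simp [glue]
  refine ⟨_, ⟨hM.1, ?_⟩, key, ?_⟩
  · intro v hv
    refine ⟨?_, (hM.2 v hv).2⟩
    have := (hM.2 v hv).1
    have := hB v
    have := key v
    simp only [mem_sdiff]
    by_cases va : v = a
    · subst va; exact absurd ka hv
    by_cases vb : v = b
    · subst vb; exact absurd kb hv
    grind
  · have : supp ν = insert a (insert b (supp (glue ν id {a, b}))) := by
      ext v
      simp only [supp, mem_filter, mem_insert, mem_univ, true_and]
      by_cases va : v = a
      · subst va; simp [hab, hne.symm]
      by_cases vb : v = b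
      · subst vb; simp [hba, hne]
      simp [va, vb, key v va vb]
    rw [this, card_insert_of_notMem, card_insert_of_notMem]
    · simp [supp, kb]
    · simp [supp, ka, hne]

theorem add_pair [Fintype α] [DecidableEq α] {prec : α → α → Prop} {V : Finset α} {ν : α → α}
    (h : IsM prec V ν) {a b : α} (ha : a ∈ V) (hb : b ∈ V) (hab : IndepJobs prec a b) :
    ∃ ν', IsM prec V ν' ∧ ν' a = b ∧ ν' b = a ∧ (∀ v, v ≠ a → v ≠ b → ν v ≠ a → ν v ≠ b → ν' v = ν v)
      ∧ (∀ v, v ≠ a → v ≠ b → (ν v = a ∨ ν v = b) → ν' v = v) := by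
  have hne := hab.1
  have hba := indep_symm hab
  refine ⟨glue ν (Equiv.swap a b) {a, b}, glue_isM h ?_, ?_, ?_, ?_, ?_⟩
  · intro v hv
    simp only [mem_insert, mem_singleton] at hv ⊢
    rcases hv with rfl | rfl
    · simp [ha, hab]
    · simp [hb, hba]
  · simp [glue]
  · simp [glue]
  · intro v h1 h2 h3 h4
    simp [glue, h1, h2, h3, h4]
  · intro v h1 h2 h3
    simp [glue, h1, h2, h3]

/-- swapping along a family of pairs -/
theorem rep [Fintype α] [DecidableEq α] {prec : α → α → Prop} {V : Finset α} {ν : α → α}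
    (h : IsM prec V ν) (S : Finset ℕ) (a b : ℕ → α)
    (hainj : ∀ i ∈ S, ∀ j ∈ S, a i = a j → i = j)
    (hbinj : ∀ i ∈ S, ∀ j ∈ S, b i = b j → i = j)
    (hdis : ∀ i ∈ S, ∀ j ∈ S, a i ≠ b j)
    (haV : ∀ i ∈ S, a i ∈ V) (hbV : ∀ i ∈ S, b i ∈ V)
    (hind : ∀ i ∈ S, IndepJobs prec (a i) (b i))
    (hcl : ∀ i ∈ S, ν (b i) = b i ∨ ∃ j ∈ S, ν (b i) = a j)
    (hch : ∀ i ∈ S, ∀ j ∈ S, ν (a i) = a j → i = j) :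
    ∃ ν', IsM prec V ν' ∧ (∀ i ∈ S, ν' (a i) = b i) ∧ (∀ i ∈ S, ν' (b i) = a i) ∧
      (∀ v, (∀ i ∈ S, v ≠ a i) → (∀ i ∈ S, v ≠ b i) → (∀ i ∈ S, ν v ≠ a i) → ν' v = ν v) ∧
      (∀ v, (∀ i ∈ S, v ≠ a i) → (∀ i ∈ S, v ≠ b i) → (∃ i ∈ S, ν v = a i) → ν' v = v) ∧
      (supp ν').card = (supp ν).card + 2 * (S.filter (fun i => ν (a i) = a i)).card := by
  classical
  let A := S.image a
  let B := S.image b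
  let τ : α → α := fun v => if h : ∃ i ∈ S, a i = v then b h.choose else
    if h : ∃ i ∈ S, b i = v then a h.choose else v
  have τa : ∀ i ∈ S, τ (a i) = b i := by
    intro i hi
    have hex : ∃ j ∈ S, a j = a i := ⟨i, hi, rfl⟩
    simp only [τ, dif_pos hex]
    rw [hainj _ hex.choose_spec.1 _ hi hex.choose_spec.2]
  have τb : ∀ i ∈ S, τ (b i) = a i := by
    intro i hi
    have hex : ∃ j ∈ S, b j = b i := ⟨i, hi, rfl⟩
    have hn : ¬ ∃ j ∈ S, a j = b i := by
      rintro ⟨j, hj, e⟩; exact hdis j hj i hi e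
    simp only [τ, dif_neg hn, dif_pos hex]
    rw [hbinj _ hex.choose_spec.1 _ hi hex.choose_spec.2]
  have mA : ∀ v, v ∈ A ↔ ∃ i ∈ S, a i = v := fun v => by simp [A]
  have mB : ∀ v, v ∈ B ↔ ∃ i ∈ S, b i = v := fun v => by simp [B]
  have hM : IsM prec V (glue ν τ (A ∪ B)) := by
    apply glue_isM h
    intro v hv
    rw [mem_union, mA, mB] at hv
    rcases hv with ⟨i, hi, rfl⟩ | ⟨i, hi, rfl⟩
    · refine ⟨?_, ?_, ?_⟩
      · rw [τa i hi, mem_union, mB]; exact Or.inr ⟨i, hi, rfl⟩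
      · rw [τa i hi, τb i hi]
      · rw [τa i hi]; exact fun _ => ⟨haV i hi, hind i hi⟩
    · refine ⟨?_, ?_, ?_⟩
      · rw [τb i hi, mem_union, mA]; exact Or.inl ⟨i, hi, rfl⟩
      · rw [τb i hi, τa i hi]
      · rw [τb i hi]; exact fun _ => ⟨hbV i hi, indep_symm (hind i hi)⟩
  have g1 : ∀ i ∈ S, glue ν τ (A ∪ B) (a i) = b i := by
    intro i hi
    have : a i ∈ A ∪ B := by rw [mem_union, mA]; exact Or.inl ⟨i, hi, rfl⟩
    rw [glue, if_pos this, τa i hi]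
  have g2 : ∀ i ∈ S, glue ν τ (A ∪ B) (b i) = a i := by
    intro i hi
    have : b i ∈ A ∪ B := by rw [mem_union, mB]; exact Or.inr ⟨i, hi, rfl⟩
    rw [glue, if_pos this, τb i hi]
  have g3 : ∀ v, (∀ i ∈ S, v ≠ a i) → (∀ i ∈ S, v ≠ b i) → (∀ i ∈ S, ν v ≠ a i) →
      glue ν τ (A ∪ B) v = ν v := by
    intro v h1 h2 h3
    have n1 : v ∉ A ∪ B := by rw [mem_union, mA, mB]; grind
    have n2 : ν v ∉ A ∪ B := by
      have := h.1 v
      rw [mem_union, mA, mB]; grind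
    rw [glue, if_neg n1, if_neg n2]
  have g4 : ∀ v, (∀ i ∈ S, v ≠ a i) → (∀ i ∈ S, v ≠ b i) → (∃ i ∈ S, ν v = a i) →
      glue ν τ (A ∪ B) v = v := by
    intro v h1 h2 h3
    have n1 : v ∉ A ∪ B := by rw [mem_union, mA, mB]; grind
    have n2 : ν v ∈ A ∪ B := by
      rw [mem_union, mA, mB]; grind
    rw [glue, if_neg n1, if_pos n2]
  refine ⟨_, hM, g1, g2, g3, g4, ?_⟩
  generalize glue ν τ (A ∪ B) = ν' at *
  let Z := supp ν \ (A ∪ A.image ν)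
  have νinj : Function.Injective ν := (show Function.Involutive ν from h.1).injective
  have cA : A.card = S.card := card_image_of_injOn (fun i hi j hj e => hainj i hi j hj e)
  have cB : B.card = S.card := card_image_of_injOn (fun i hi j hj e => hbinj i hi j hj e)
  have e1 : supp ν' = Z ∪ (A ∪ B) := by
    ext v
    simp only [Z, supp, mem_union, mem_sdiff, mem_filter, mem_univ, true_and, mA, mB, mem_image]
    have := h.1 v
    by_cases c1 : ∃ i ∈ S, a i = v
    · obtain ⟨i, hi, rfl⟩ := c1
      have := g1 i hi
      have := hdis i hi i hi
      grind
    by_cases c2 : ∃ i ∈ S, b i = v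
    · obtain ⟨i, hi, rfl⟩ := c2
      have := g2 i hi
      have := hdis i hi i hi
      grind
    by_cases c3 : ∃ i ∈ S, ν v = a i
    · have := g4 v (by grind) (by grind) c3
      grind
    · have := g3 v (by grind) (by grind) (by grind)
      grind
  have d1 : Disjoint Z (A ∪ B) := by
    rw [Finset.disjoint_left]
    intro v hv
    simp only [Z, supp, mem_union, mem_sdiff, mem_filter, mem_univ, true_and, mA, mB, mem_image] at hv ⊢
    rintro (hc | ⟨i, hi, rfl⟩)
    · exact hv.2 (Or.inl hc)
    · have := hcl i hi
      have := h.1 (b i)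
      grind
  have d2 : Disjoint A B := by
    rw [Finset.disjoint_left]
    intro v hv hv'
    rw [mA] at hv; rw [mB] at hv'
    grind
  let A1 := A.filter (fun v => ν v ≠ v)
  have e2 : supp ν = Z ∪ (A1 ∪ A1.image ν) := by
    ext v
    simp only [Z, A1, supp, mem_union, mem_sdiff, mem_filter, mem_univ, true_and, mem_image]
    have := h.1 v
    grind
  have d3 : Disjoint Z (A1 ∪ A1.image ν) := by
    rw [Finset.disjoint_left]
    intro v hv
    simp only [Z, A1, supp, mem_union, mem_sdiff, mem_filter, mem_univ, true_and, mem_image] at hv ⊢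
    grind
  have d4 : Disjoint A1 (A1.image ν) := by
    rw [Finset.disjoint_left]
    intro v hv
    simp only [A1, mem_filter, mem_image, mA] at hv ⊢
    have := h.1 v
    grind
  have c1 : (S.filter (fun i => ν (a i) = a i)).card + A1.card = S.card := by
    have : A1.card = (S.filter (fun i => ¬ ν (a i) = a i)).card := by
      have : A1 = (S.filter (fun i => ¬ ν (a i) = a i)).image a := by
        ext v
        simp only [A1, mem_filter, mem_image, mA]
        grind
      rw [this]
      apply card_image_of_injOn
      intro i hi j hj e
      simp at hi hj
      exact hainj i hi.1 j hj.1 e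
    rw [this]
    exact card_filter_add_card_filter_not _
  rw [e1, card_union_of_disjoint d1, card_union_of_disjoint d2, e2, card_union_of_disjoint d3,
    card_union_of_disjoint d4, card_image_of_injective _ νinj, cA, cB]
  omega

end RL

namespace RL

variable {α : Type*}

theorem IsCh.inj {prec : α → α → Prop} (hirr : ∀ i, ¬ prec i i) {V : Finset α} {L : ℕ}
    {p : ℕ → α} (hp : IsCh prec V L p) {i j : ℕ} (hi : i < L) (hj : j < L) (h : p i = p j) :
    i = j := by
  rcases lt_trichotomy i j with h1 | h1 | h1
  · have := hp.2 i j h1 hj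
    rw [h] at this
    exact absurd this (hirr _)
  · exact h1
  · have := hp.2 j i h1 hi
    rw [h] at this
    exact absurd this (hirr _)

theorem cross {prec : α → α → Prop} (ht : ∀ a b c, prec a b → prec b c → prec a c)
    {V : Finset α} {L : ℕ} {p c : ℕ → α} (hp : IsCh prec V L p) (hc : IsCh prec V L c)
    (hno : ∀ q, ¬ IsCh prec V (L + 1) q) {i : ℕ} (hi : i < L) : ¬ prec (p i) (c i) := by
  intro h
  have hle1 : ∀ k, k ≤ i → k = i ∨ prec (p k) (p i) := by
    intro k hk
    rcases Nat.lt_or_ge k i with h1 | h1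
    · exact Or.inr (hp.2 k i h1 hi)
    · left; omega
  have hle2 : ∀ k, i ≤ k → k < L → k = i ∨ prec (c i) (c k) := by
    intro k hk hkL
    rcases Nat.lt_or_ge i k with h1 | h1
    · exact Or.inr (hc.2 i k h1 hkL)
    · left; omega
  apply hno (fun k => if k ≤ i then p k else c (k - 1))
  constructor
  · intro k hk
    dsimp only
    split_ifs with h1
    · exact hp.1 k (by omega)
    · exact hc.1 _ (by omega)
  · intro k l hkl hl
    dsimp only
    split_ifs with h1 h2 h2
    · exact hp.2 k l hkl (by omega)
    · have h3 : prec (p k) (c i) := by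
        rcases hle1 k h1 with rfl | h4
        · exact h
        · exact ht _ _ _ h4 h
      rcases hle2 (l - 1) (by omega) (by omega) with h4 | h4
      · rw [h4]; exact h3
      · exact ht _ _ _ h3 h4
    · omega
    · exact hc.2 _ _ (by omega) (by omega)

theorem cross_idx {prec : α → α → Prop} (ht : ∀ a b c, prec a b → prec b c → prec a c)
    {V : Finset α} {L : ℕ} {p c : ℕ → α} (hp : IsCh prec V L p) (hc : IsCh prec V L c)
    (hno : ∀ q, ¬ IsCh prec V (L + 1) q) {i j : ℕ} (hi : i < L) (hj : j < L) (h : p i = c j) :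
    i = j := by
  rcases lt_trichotomy i j with h1 | h1 | h1
  · have := hc.2 i j h1 hj
    rw [← h] at this
    exact absurd this (cross ht hc hp hno hi)
  · exact h1
  · have := hp.2 j i h1 hi
    rw [h] at this
    exact absurd this (cross ht hp hc hno hj)

theorem head_src {prec : α → α → Prop} (ht : ∀ a b c, prec a b → prec b c → prec a c)
    {V : Finset α} {L : ℕ} {p : ℕ → α} (hp : IsCh prec V L p)
    (hno : ∀ q, ¬ IsCh prec V (L + 1) q) (hL : 0 < L) : Src prec V (p 0) := by
  refine ⟨hp.1 0 hL, fun w hw h => hno (fun k => if k = 0 then w else p (k - 1)) ⟨?_, ?_⟩⟩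
  · intro i hi
    dsimp only
    split_ifs
    · exact hw
    · exact hp.1 _ (by omega)
  · intro i j hij hj
    dsimp only
    split_ifs with h1 h2 h2
    · omega
    · rcases Nat.eq_zero_or_pos (j - 1) with h3 | h3
      · rw [h3]; exact h
      · exact ht _ _ _ h (hp.2 0 _ h3 (by omega))
    · omega
    · exact hp.2 _ _ (by omega) (by omega)

theorem src_below [Finite α] {prec : α → α → Prop} (ht : ∀ a b c, prec a b → prec b c → prec a c)
    (hirr : ∀ i, ¬ prec i i) {V : Finset α} {v : α} (hv : v ∈ V) (hn : ¬ Src prec V v) :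
    ∃ w, Src prec V w ∧ prec w v := by
  haveI : IsTrans α prec := ⟨ht⟩
  haveI : Std.Irrefl prec := ⟨hirr⟩
  have wf : WellFounded prec := Finite.wellFounded_of_trans_of_irrefl prec
  have hne : {w | w ∈ V ∧ prec w v}.Nonempty := by
    unfold Src at hn
    push Not at hn
    obtain ⟨w, hw, h⟩ := hn hv
    exact ⟨w, hw, h⟩
  obtain ⟨w, ⟨hw, hwv⟩, hmin⟩ := wf.has_min _ hne
  exact ⟨w, ⟨hw, fun z hz hzw => hmin z ⟨hz, ht _ _ _ hzw hwv⟩ hzw⟩, hwv⟩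

theorem src_indep {prec : α → α → Prop} {V : Finset α} {v w : α} (hv : Src prec V v)
    (hw : Src prec V w) (hne : v ≠ w) : IndepJobs prec v w :=
  ⟨hne, hw.2 v hv.1, hv.2 w hw.1⟩

theorem nsrc {prec : α → α → Prop} {V : Finset α} {L : ℕ} {p : ℕ → α} (hp : IsCh prec V L p)
    {i : ℕ} (hi : i < L) (h0 : 0 < i) : ¬ Src prec V (p i) :=
  fun h => h.2 _ (hp.1 0 (by omega)) (hp.2 0 i h0 hi)

/-- in a matching, no two members of a chain are partners -/
theorem nmatch {prec : α → α → Prop} (hirr : ∀ i, ¬ prec i i) {V : Finset α} {L : ℕ} {p : ℕ → α} (hp : IsCh prec V L p)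
    {ν : α → α} (hM : IsM prec V ν) {i j : ℕ} (hi : i < L) (hj : j < L) (h : ν (p i) = p j) :
    i = j := by
  by_contra hne
  by_cases hf : p j = p i
  · exact hne (IsCh.inj hirr hp hi hj hf.symm)
  · have h3 := (hM.2 (p i) (by rw [h]; exact hf)).2
    rw [h] at h3
    rcases Nat.lt_or_gt_of_ne hne with h1 | h1
    · exact h3.2.1 (hp.2 i j h1 hj)
    · exact h3.2.2 (hp.2 j i h1 hi)

def TT [Fintype α] [DecidableEq α] (prec : α → α → Prop) (V : Finset α) : Prop :=
  ∀ L p ν, IsCh prec V L p → (∀ q, ¬ IsCh prec V (L + 1) q) → IsM prec V ν →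
    Good prec V (supp ν).card (unc ν p L)

theorem ch_mono {prec : α → α → Prop} {V W : Finset α} (h : V ⊆ W) {L : ℕ} {p : ℕ → α}
    (hp : IsCh prec V L p) : IsCh prec W L p := ⟨fun i hi => h (hp.1 i hi), hp.2⟩

/-- Case 0: a matched pair of sources avoiding the critical chain. -/
theorem core0 [Fintype α] [DecidableEq α] {prec : α → α → Prop} {V : Finset α}
    (IH : ∀ W, W ⊂ V → TT prec W) {L : ℕ} {p : ℕ → α} {ν : α → α}
    (hp : IsCh prec V L p) (hno : ∀ q, ¬ IsCh prec V (L + 1) q) (hM : IsM prec V ν)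
    {c d : α} (hc : Src prec V c) (hd : Src prec V d) (hcd : ν c = d) (hne : c ≠ d)
    (hcp : c ≠ p 0) (hdp : d ≠ p 0) : Good prec V (supp ν).card (unc ν p L) := by
  obtain ⟨ν', hM', hν', hs⟩ := del_pair hM hcd hne {c, d} (by simp) (by simp)
    (by intro v hv; simp at hv; grind)
  have hpc : ∀ i, i < L → p i ≠ c ∧ p i ≠ d := by
    intro i hi
    rcases Nat.eq_zero_or_pos i with rfl | h0
    · exact ⟨hcp.symm, hdp.symm⟩
    · have := nsrc hp hi h0
      exact ⟨fun e => this (e ▸ hc), fun e => this (e ▸ hd)⟩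
  have hsub : V \ {c, d} ⊂ V := by
    refine ⟨sdiff_subset, fun h => ?_⟩
    have := h hc.1
    simp at this
  obtain ⟨M, x, hx, h1, h2⟩ := IH _ hsub L p ν'
    ⟨fun i hi => by simp [hp.1 i hi, hpc i hi], hp.2⟩
    (fun q hq => hno q (ch_mono sdiff_subset hq)) hM'
  obtain ⟨x', hx', hF⟩ := step_block (B := {c, d}) (by intro b hb; simp at hb; grind) hx
  have hu : unc ν' p L = unc ν p L := by
    unfold unc
    congr 1
    apply Finset.filter_congr
    intro i hi
    have := hpc i (by simpa using hi)
    rw [hν' _ this.1 this.2]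
  have hcard : ({c, d} : Finset α).card = 2 := card_pair hne
  refine ⟨M + 1, x', hx', by omega, ?_⟩
  rw [hF, hcard]
  simp only [min_self]
  omega

theorem unc_shift [DecidableEq α] (ν : α → α) (p : ℕ → α) (L : ℕ) :
    unc ν p (L + 1) = unc ν (fun i => p (i + 1)) L + if ν (p 0) = p 0 then 1 else 0 := by
  unfold unc
  rw [card_filter, card_filter, Finset.sum_range_succ']

theorem shift_ch {prec : α → α → Prop} (hirr : ∀ i, ¬ prec i i) [DecidableEq α] {V B : Finset α} {L : ℕ}
    {p : ℕ → α} (hp : IsCh prec V (L + 1) p) (hB : ∀ b ∈ B, Src prec V b) :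
    IsCh prec (V \ B) L (fun i => p (i + 1)) := by
  refine ⟨fun i hi => ?_, fun i j hij hj => hp.2 _ _ (by omega) (by omega)⟩
  have h1 := nsrc hp (i := i + 1) (by omega) (by omega)
  simp only [mem_sdiff]
  exact ⟨hp.1 _ (by omega), fun h => h1 (hB _ h)⟩

end RL

namespace RL

variable {α : Type*}

/-- the alternating-path relation between two longest chains -/
def E (ν : α → α) (p c : ℕ → α) (L : ℕ) (i j : ℕ) : Prop :=
  i < L ∧ p i ≠ c i ∧ j < L ∧ ν (c i) = p j

section
variable {prec : α → α → Prop} (ht : ∀ a b c, prec a b → prec b c → prec a c)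
  (hirr : ∀ i, ¬ prec i i) {V : Finset α} {L : ℕ} {p c : ℕ → α} {ν : α → α}

theorem E_dom (hirr : ∀ i, ¬ prec i i)
    (hc : IsCh prec V L c)
    (hM : IsM prec V ν) {i j : ℕ} (h : E ν p c L i j) :
    j < L ∧ p j ≠ c j := by
  obtain ⟨h1, h2, h3, h4⟩ := h
  refine ⟨h3, fun e => ?_⟩
  have := nmatch hirr hc hM h1 h3 (h4.trans e)
  subst this
  exact h2 e

theorem reach_dom (hirr : ∀ i, ¬ prec i i)
    (hc : IsCh prec V L c)
    (hM : IsM prec V ν) {i j : ℕ} (hi : i < L ∧ p i ≠ c i)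
    (h : Relation.ReflTransGen (E ν p c L) i j) :
    j < L ∧ p j ≠ c j := by
  rcases Relation.ReflTransGen.cases_tail h with rfl | ⟨k, _, hk⟩
  · exact hi
  · exact E_dom hirr hc hM hk

theorem E_unique (hirr : ∀ i, ¬ prec i i) (hp : IsCh prec V L p) :
    Relator.RightUnique (E ν p c L) := by
  intro i j k h1 h2
  exact IsCh.inj hirr hp h1.2.2.1 h2.2.2.1 (h1.2.2.2.symm.trans h2.2.2.2)

/-- a unique terminal vertex is reachable -/
theorem term_unique (hirr : ∀ i, ¬ prec i i) (hp : IsCh prec V L p) {i s t : ℕ}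
    (hs : Relation.ReflTransGen (E ν p c L) i s) (htt : Relation.ReflTransGen (E ν p c L) i t)
    (hs' : ∀ k, ¬ E ν p c L s k) (ht' : ∀ k, ¬ E ν p c L t k) : s = t := by
  rcases Relation.ReflTransGen.total_of_right_unique (E_unique hirr hp) hs htt with h | h
  · rcases Relation.ReflTransGen.cases_head h with h | ⟨k, hk, _⟩
    · exact h
    · exact absurd hk (hs' k)
  · rcases Relation.ReflTransGen.cases_head h with h | ⟨k, hk, _⟩
    · exact h.symm
    · exact absurd hk (ht' k)

theorem fix_term (ht : ∀ a b c, prec a b → prec b c → prec a c) (hp : IsCh prec V L p)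
    (hc : IsCh prec V L c)
    (hno : ∀ q, ¬ IsCh prec V (L + 1) q) {t : ℕ}
    (hf : ν (c t) = c t) (k : ℕ) : ¬ E ν p c L t k := by
  rintro ⟨h1, h2, h3, h4⟩
  have := cross_idx ht hp hc hno h3 h1 (h4.symm.trans hf)
  subst this
  exact h2 (h4.symm.trans hf)

theorem D_indep (ht : ∀ a b c, prec a b → prec b c → prec a c) (hp : IsCh prec V L p)
    (hc : IsCh prec V L c) (hno : ∀ q, ¬ IsCh prec V (L + 1) q) {i : ℕ} (hi : i < L)
    (h : p i ≠ c i) : IndepJobs prec (p i) (c i) :=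
  ⟨h, cross ht hp hc hno hi, cross ht hc hp hno hi⟩

theorem improve [Fintype α] [DecidableEq α]
    (ht : ∀ a b c, prec a b → prec b c → prec a c) (hirr : ∀ i, ¬ prec i i)
    (hp : IsCh prec V L p) (hc : IsCh prec V L c) (hno : ∀ q, ¬ IsCh prec V (L + 1) q)
    (hM : IsM prec V ν) (hL : 0 < L) (hp0 : ν (p 0) = p 0) (hc0 : ν (c 0) ≠ c 0) :
    ∃ ν', IsM prec V ν' ∧ (supp ν).card ≤ (supp ν').card ∧
      (supp ν').card + 2 * unc ν' p L ≤ (supp ν).card + 2 * unc ν p L ∧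
      unc ν' p L < unc ν p L := by
  classical
  have h0 : 0 < L ∧ p 0 ≠ c 0 := ⟨hL, fun e => hc0 (e ▸ hp0)⟩
  let S := (range L).filter (fun i => Relation.ReflTransGen (E ν p c L) 0 i)
  have mS : ∀ i, i ∈ S ↔ Relation.ReflTransGen (E ν p c L) 0 i := by
    intro i
    simp only [S, mem_filter, mem_range, and_iff_right_iff_imp]
    exact fun h => (reach_dom hirr hc hM h0 h).1
  have dS : ∀ i ∈ S, i < L ∧ p i ≠ c i := fun i hi => reach_dom hirr hc hM h0 ((mS i).1 hi)
  obtain ⟨ν', hM', g1, g2, g3, g4, hs⟩ := rep hM S c p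
    (fun i hi j hj e => IsCh.inj hirr hc (dS i hi).1 (dS j hj).1 e)
    (fun i hi j hj e => IsCh.inj hirr hp (dS i hi).1 (dS j hj).1 e)
    (fun i hi j hj e => by
      have := cross_idx ht hc hp hno (dS i hi).1 (dS j hj).1 e
      subst this
      exact (dS i hi).2 e.symm)
    (fun i hi => hc.1 i (dS i hi).1) (fun i hi => hp.1 i (dS i hi).1)
    (fun i hi => indep_symm (D_indep ht hp hc hno (dS i hi).1 (dS i hi).2))
    (fun i hi => by
      rcases Relation.ReflTransGen.cases_tail ((mS i).1 hi) with h | ⟨k, hk, hk'⟩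
      · subst h; exact Or.inl hp0
      · exact Or.inr ⟨k, (mS k).2 hk, by rw [← hk'.2.2.2, hM.1]⟩)
    (fun i hi j hj e => nmatch hirr hc hM (dS i hi).1 (dS j hj).1 e)
  have hle : (S.filter (fun i => ν (c i) = c i)).card ≤ 1 := by
    rw [card_le_one]
    intro i hi j hj
    rw [mem_filter, mS] at hi hj
    exact term_unique hirr hp hi.1 hj.1 (fix_term ht hp hc hno hi.2) (fix_term ht hp hc hno hj.2)
  have hu : unc ν' p L < unc ν p L := by
    unfold unc
    apply card_lt_card
    rw [Finset.ssubset_iff_of_subset]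
    · refine ⟨0, by simp [hL, hp0], ?_⟩
      have : (0 : ℕ) ∈ S := (mS 0).2 Relation.ReflTransGen.refl
      simp only [mem_filter, not_and]
      intro _
      rw [g2 0 this]
      exact h0.2.symm
    · intro i hi
      simp only [mem_filter, mem_range] at hi ⊢
      refine ⟨hi.1, ?_⟩
      have hiS : i ∉ S := by
        intro h
        have h1 := g2 i h
        rw [hi.2] at h1
        exact (dS i h).2 h1
      rw [← g3 (p i), hi.2]
      · intro j hj e
        have := cross_idx ht hp hc hno hi.1 (dS j hj).1 e
        subst this
        exact hiS hj
      · intro j hj e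
        have := IsCh.inj hirr hp hi.1 (dS j hj).1 e
        subst this
        exact hiS hj
      · intro j hj e
        apply hiS
        rw [mS]
        refine Relation.ReflTransGen.tail ((mS j).1 hj) ⟨(dS j hj).1, (dS j hj).2, hi.1, ?_⟩
        rw [← e, hM.1]
  exact ⟨ν', hM', by omega, by omega, hu⟩

theorem freeup [Fintype α] [DecidableEq α]
    (ht : ∀ a b c, prec a b → prec b c → prec a c) (hirr : ∀ i, ¬ prec i i)
    (hp : IsCh prec V L p) (hc : IsCh prec V L c) (hno : ∀ q, ¬ IsCh prec V (L + 1) q)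
    (hM : IsM prec V ν) (hL : 0 < L) (hp0 : ν (p 0) ≠ p 0) (ha : Src prec V (ν (p 0)))
    (hc0 : ν (c 0) ≠ c 0) (hpc : p 0 ≠ c 0) (hac : ν (p 0) ≠ c 0)
    (hend : ∀ i, Relation.ReflTransGen (E ν p c L) 0 i → ν (c i) = c i ∨ ∃ j, j < L ∧ ν (c i) = p j) :
    ∃ ν', IsM prec V ν' ∧ (supp ν').card = (supp ν).card ∧
      unc ν' p L ≤ unc ν p L ∧ ν' (p 0) = c 0 ∧ ν' (ν (p 0)) = ν (p 0) ∧
      (∀ v, Src prec V v → ν' v ≠ v → ν v ≠ v) := by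
  classical
  have h0 : 0 < L ∧ p 0 ≠ c 0 := ⟨hL, hpc⟩
  let S := (range L).filter (fun i => Relation.ReflTransGen (E ν p c L) 0 i)
  have mS : ∀ i, i ∈ S ↔ Relation.ReflTransGen (E ν p c L) 0 i := by
    intro i
    simp only [S, mem_filter, mem_range, and_iff_right_iff_imp]
    exact fun h => (reach_dom hirr hc hM h0 h).1
  have dS : ∀ i ∈ S, i < L ∧ p i ≠ c i := fun i hi => reach_dom hirr hc hM h0 ((mS i).1 hi)
  have S0 : (0 : ℕ) ∈ S := (mS 0).2 Relation.ReflTransGen.refl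
  obtain ⟨ν', hM', g1, g2, g3, g4, hs⟩ := rep hM S p c
    (fun i hi j hj e => IsCh.inj hirr hp (dS i hi).1 (dS j hj).1 e)
    (fun i hi j hj e => IsCh.inj hirr hc (dS i hi).1 (dS j hj).1 e)
    (fun i hi j hj e => by
      have := cross_idx ht hp hc hno (dS i hi).1 (dS j hj).1 e
      subst this
      exact (dS i hi).2 e)
    (fun i hi => hp.1 i (dS i hi).1) (fun i hi => hc.1 i (dS i hi).1)
    (fun i hi => D_indep ht hp hc hno (dS i hi).1 (dS i hi).2)
    (fun i hi => by
      rcases hend i ((mS i).1 hi) with h | ⟨j, hj, h⟩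
      · exact Or.inl h
      · refine Or.inr ⟨j, ?_, h⟩
        rw [mS]
        exact Relation.ReflTransGen.tail ((mS i).1 hi) ⟨(dS i hi).1, (dS i hi).2, hj, h⟩)
    (fun i hi j hj e => nmatch hirr hp hM (dS i hi).1 (dS j hj).1 e)
  have hpS : ∀ i ∈ S, ν (p i) ≠ p i := by
    intro i hi e
    rcases Relation.ReflTransGen.cases_tail ((mS i).1 hi) with h | ⟨k, hk, hk'⟩
    · subst h; exact hp0 e
    · have h1 : ν (p i) = c k := by rw [← hk'.2.2.2, hM.1]
      have h2 := cross_idx ht hp hc hno (dS i hi).1 hk'.1 (e.symm.trans h1)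
      subst h2
      exact hk'.2.1 (e.symm.trans h1)
  have hfe : S.filter (fun i => ν (p i) = p i) = ∅ := by
    apply filter_eq_empty_iff.2
    intro i hi
    exact hpS i hi
  refine ⟨ν', hM', by rw [hs, hfe]; simp, ?_, g1 0 S0, ?_, ?_⟩
  · unfold unc
    apply card_le_card
    intro i hi
    simp only [mem_filter, mem_range] at hi ⊢
    refine ⟨hi.1, ?_⟩
    have hiS : i ∉ S := by
      intro h
      have h1 := g1 i h
      rw [hi.2] at h1
      exact (dS i h).2 h1
    rw [← g3 (p i), hi.2]
    · intro j hj e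
      have := IsCh.inj hirr hp hi.1 (dS j hj).1 e
      subst this
      exact hiS hj
    · intro j hj e
      have := cross_idx ht hp hc hno hi.1 (dS j hj).1 e
      subst this
      exact hiS hj
    · intro j hj e
      have := nmatch hirr hp hM hi.1 (dS j hj).1 e
      subst this
      exact hiS hj
  · apply g4
    · intro i hi e
      rcases Nat.eq_zero_or_pos i with h | h
      · subst h; exact hp0 e
      · exact nsrc hp (dS i hi).1 h (e ▸ ha)
    · intro i hi e
      rcases Nat.eq_zero_or_pos i with h | h
      · subst h; exact hac e
      · exact nsrc hc (dS i hi).1 h (e ▸ ha)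
    · exact ⟨0, S0, hM.1 _⟩
  · intro v hv hv'
    by_cases k1 : ∃ i ∈ S, v = p i
    · obtain ⟨i, hi, rfl⟩ := k1
      exact hpS i hi
    by_cases k2 : ∃ i ∈ S, v = c i
    · obtain ⟨i, hi, rfl⟩ := k2
      rcases Nat.eq_zero_or_pos i with h | h
      · subst h; exact hc0
      · exact absurd hv (nsrc hc (dS i hi).1 h)
    by_cases k3 : ∃ i ∈ S, ν v = p i
    · exact absurd (g4 v (by grind) (by grind) k3) hv'
    · rw [← g3 v (by grind) (by grind) (by grind)]; exact hv'

theorem transfer [Fintype α] [DecidableEq α]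
    (ht : ∀ a b c, prec a b → prec b c → prec a c) (hirr : ∀ i, ¬ prec i i)
    (hp : IsCh prec V L p) (hc : IsCh prec V L c) (hno : ∀ q, ¬ IsCh prec V (L + 1) q)
    (hM : IsM prec V ν) (hL : 0 < L) (hpc : p 0 ≠ c 0)
    {t0 : ℕ} (hreach : Relation.ReflTransGen (E ν p c L) 0 t0) (hend : ν (c t0) ≠ c t0)
    (hend' : ∀ j, j < L → ν (c t0) ≠ p j) :
    ∃ ν', IsM prec V ν' ∧ (supp ν).card ≤ (supp ν').card ∧
      (supp ν').card + 2 * unc ν' c L ≤ (supp ν).card + 2 * unc ν p L ∧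
      ν' (p 0) = ν (p 0) := by
  classical
  let S := (range L).filter (fun i => p i ≠ c i ∧
    ∃ t, Relation.ReflTransGen (E ν p c L) i t ∧ ν (c t) = c t)
  have mS : ∀ i, i ∈ S ↔ i < L ∧ p i ≠ c i ∧
    ∃ t, Relation.ReflTransGen (E ν p c L) i t ∧ ν (c t) = c t := by
    intro i
    simp only [S, mem_filter, mem_range]
  have dS : ∀ i ∈ S, i < L ∧ p i ≠ c i := fun i hi => ⟨((mS i).1 hi).1, ((mS i).1 hi).2.1⟩
  have S0 : (0 : ℕ) ∉ S := by
    intro h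
    obtain ⟨_, _, t, h1, h2⟩ := (mS 0).1 h
    have := term_unique hirr hp h1 hreach (fix_term ht hp hc hno h2)
      (fun k hk => hend' k hk.2.2.1 hk.2.2.2)
    subst this
    exact hend h2
  obtain ⟨ν', hM', g1, g2, g3, g4, hs⟩ := rep hM S p c
    (fun i hi j hj e => IsCh.inj hirr hp (dS i hi).1 (dS j hj).1 e)
    (fun i hi j hj e => IsCh.inj hirr hc (dS i hi).1 (dS j hj).1 e)
    (fun i hi j hj e => by
      have := cross_idx ht hp hc hno (dS i hi).1 (dS j hj).1 e
      subst this
      exact (dS i hi).2 e)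
    (fun i hi => hp.1 i (dS i hi).1) (fun i hi => hc.1 i (dS i hi).1)
    (fun i hi => D_indep ht hp hc hno (dS i hi).1 (dS i hi).2)
    (fun i hi => by
      obtain ⟨_, _, t, h1, h2⟩ := (mS i).1 hi
      rcases Relation.ReflTransGen.cases_head h1 with h | ⟨k, hk, hk'⟩
      · subst h; exact Or.inl h2
      · refine Or.inr ⟨k, ?_, hk.2.2.2⟩
        have := E_dom hirr hc hM hk
        exact (mS k).2 ⟨this.1, this.2, t, hk', h2⟩)
    (fun i hi j hj e => nmatch hirr hp hM (dS i hi).1 (dS j hj).1 e)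
  have hu : unc ν' c L + (S.filter (fun i => ν (p i) = p i)).card ≤ unc ν p L := by
    unfold unc
    have key : ∀ i, i < L → ν' (c i) = c i → i ∉ S ∧ ν (p i) = p i := by
      intro i hi hf
      have hiS : i ∉ S := by
        intro h
        have h1 := g2 i h
        rw [hf] at h1
        exact (dS i h).2 h1.symm
      refine ⟨hiS, ?_⟩
      have h1 : ν' (c i) = ν (c i) := by
        apply g3
        · intro j hj e
          have := cross_idx ht hc hp hno hi (dS j hj).1 e
          subst this
          exact hiS hj
        · intro j hj e
          have := IsCh.inj hirr hc hi (dS j hj).1 e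
          subst this
          exact hiS hj
        · intro j hj e
          by_cases hd : p i = c i
          · rw [← hd] at e
            have := nmatch hirr hp hM hi (dS j hj).1 e
            subst this
            exact hiS hj
          · obtain ⟨_, _, t, k1, k2⟩ := (mS j).1 hj
            exact hiS ((mS i).2 ⟨hi, hd, t,
              Relation.ReflTransGen.head ⟨hi, hd, (dS j hj).1, e⟩ k1, k2⟩)
      by_cases hd : p i = c i
      · rw [hd, ← h1, hf]
      · exact absurd ((mS i).2 ⟨hi, hd, i, Relation.ReflTransGen.refl, h1.symm.trans hf⟩) hiS
    rw [← card_union_of_disjoint]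
    · apply card_le_card
      intro i hi
      simp only [mem_union, mem_filter, mem_range] at hi ⊢
      rcases hi with hi | hi
      · exact ⟨hi.1, (key i hi.1 hi.2).2⟩
      · exact ⟨(dS i hi.1).1, hi.2⟩
    · rw [Finset.disjoint_left]
      intro i hi hi'
      simp only [mem_filter, mem_range] at hi hi'
      exact (key i hi.1 hi.2).1 hi'.1
  refine ⟨ν', hM', by omega, by omega, ?_⟩
  apply g3
  · intro j hj e
    have := IsCh.inj hirr hp hL (dS j hj).1 e
    subst this
    exact S0 hj
  · intro j hj e
    have := cross_idx ht hp hc hno hL (dS j hj).1 e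
    subst this
    exact S0 hj
  · intro j hj e
    have := nmatch hirr hp hM hL (dS j hj).1 e
    subst this
    exact S0 hj

end

end RL

namespace RL

variable {α : Type*}

theorem unc_le [DecidableEq α] {ν ν' : α → α} {p : ℕ → α} {L : ℕ}
    (h : ∀ i, i < L → ν' (p i) = p i → ν (p i) = p i) : unc ν' p L ≤ unc ν p L := by
  unfold unc
  apply card_le_card
  intro i hi
  simp only [mem_filter, mem_range] at hi ⊢
  exact ⟨hi.1, h i hi.1 hi.2⟩

theorem core2a [Fintype α] [DecidableEq α] {prec : α → α → Prop}
    (ht : ∀ a b c, prec a b → prec b c → prec a c) (hirr : ∀ i, ¬ prec i i) {V : Finset α}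
    (IH : ∀ W, W ⊂ V → TT prec W) {L : ℕ} {p : ℕ → α}
    (hp : IsCh prec V L p) (hno : ∀ q, ¬ IsCh prec V (L + 1) q) (hL : 0 < L) (n : ℕ) :
    ∀ {ν : α → α}, IsM prec V ν → ν (p 0) ≠ p 0 → Src prec V (ν (p 0)) →
      {v | Src prec V v ∧ ν v ≠ v}.ncard = n → Good prec V (supp ν).card (unc ν p L) := by
  classical
  induction n using Nat.strong_induction_on with
  | _ n ih =>
  intro ν hM hp0 ha hn
  have hs0 := head_src ht hp hno hL
  by_cases hb : ∃ c, IsCh prec V L c ∧ ν (c 0) ≠ c 0 ∧ c 0 ≠ p 0 ∧ c 0 ≠ ν (p 0)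
  · obtain ⟨c, hc, hc0, hcp, hca⟩ := hb
    by_cases hend : ∀ i, Relation.ReflTransGen (E ν p c L) 0 i →
        ν (c i) = c i ∨ ∃ j, j < L ∧ ν (c i) = p j
    · obtain ⟨ν', hM', h1, h2, h3, h4, h5⟩ :=
        freeup ht hirr hp hc hno hM hL hp0 ha hc0 hcp.symm hca.symm hend
      have hlt : {v | Src prec V v ∧ ν' v ≠ v}.ncard < n := by
        rw [← hn]
        apply Set.ncard_lt_ncard _ (Set.toFinite _)
        rw [Set.ssubset_iff_of_subset]
        · refine ⟨ν (p 0), ⟨ha, ?_⟩, fun h => h.2 h4⟩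
          rw [hM.1]; exact hp0.symm
        · intro v hv
          exact ⟨hv.1, h5 v hv.1 hv.2⟩
      refine (ih _ hlt hM' (by rw [h3]; exact hcp) (by rw [h3]; exact head_src ht hc hno hL)
        rfl).mono (by omega) (by omega)
    · push Not at hend
      obtain ⟨t0, hr, he1, he2⟩ := hend
      obtain ⟨ν', hM', h1, h2, h3⟩ := transfer ht hirr hp hc hno hM hL hcp.symm hr he1 he2
      obtain ⟨ν2, hM2, hν2, hs⟩ := del_pair hM' h3 hp0.symm {p 0, ν (p 0)} (by simp) (by simp)
        (by intro v hv; simp at hv; grind)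
      have hpc : ∀ i, i < L → c i ≠ p 0 ∧ c i ≠ ν (p 0) := by
        intro i hi
        rcases Nat.eq_zero_or_pos i with rfl | h0
        · exact ⟨hcp, hca⟩
        · have := nsrc hc hi h0
          exact ⟨fun e => this (e ▸ hs0), fun e => this (e ▸ ha)⟩
      have hsub : V \ {p 0, ν (p 0)} ⊂ V := by
        refine ⟨sdiff_subset, fun h => ?_⟩
        have := h hs0.1
        simp at this
      obtain ⟨M, x, hx, k1, k2⟩ := IH _ hsub L c ν2
        ⟨fun i hi => by simp [hc.1 i hi, hpc i hi], hc.2⟩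
        (fun q hq => hno q (ch_mono sdiff_subset hq)) hM2
      obtain ⟨x', hx', hF⟩ := step_block (B := {p 0, ν (p 0)})
        (by intro b hb; simp at hb; grind) hx
      have hu : unc ν2 c L ≤ unc ν' c L := by
        apply unc_le
        intro i hi e
        rw [← hν2 _ (hpc i hi).1 (hpc i hi).2, e]
      have hcard : ({p 0, ν (p 0)} : Finset α).card = 2 := card_pair hp0.symm
      refine ⟨M + 1, x', hx', by omega, ?_⟩
      rw [hF, hcard]
      simp only [min_self]
      omega
  · push Not at hb
    obtain ⟨L, rfl⟩ : ∃ L', L = L' + 1 := ⟨L - 1, by omega⟩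
    let B := V.filter (fun v => Src prec V v ∧ (ν v = v ∨ v = p 0 ∨ v = ν (p 0)))
    have mB : ∀ v, v ∈ B ↔ Src prec V v ∧ (ν v = v ∨ v = p 0 ∨ v = ν (p 0)) := by
      intro v
      simp only [B, mem_filter, and_iff_right_iff_imp]
      exact fun h => h.1.1
    have b1 : p 0 ∈ B := (mB _).2 ⟨hs0, by simp⟩
    have b2 : ν (p 0) ∈ B := (mB _).2 ⟨ha, by simp⟩
    obtain ⟨ν2, hM2, hν2, hs⟩ := del_pair hM rfl hp0.symm B b1 b2
        (by intro v hv; have := (mB v).1 hv; grind)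
    have hsub : V \ B ⊂ V := by
      refine ⟨sdiff_subset, fun h => ?_⟩
      have := h hs0.1
      simp [b1] at this
    obtain ⟨M, x, hx, k1, k2⟩ := IH _ hsub L (fun i => p (i + 1)) ν2
      (shift_ch hirr hp (fun b hb => ((mB b).1 hb).1)) (by
        intro q hq
        have hq' := ch_mono sdiff_subset hq
        have hq0 := head_src ht hq' hno hL
        have h1 : q 0 ∉ B := by
          have := hq.1 0 hL
          simp at this
          exact this.2
        have h2 := hb q hq'
        rw [mB] at h1
        grind) hM2
    obtain ⟨x', hx', hF⟩ := step_block (B := B) (fun b hb => ((mB b).1 hb).1) hx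
    have hu : unc ν2 (fun i => p (i + 1)) L ≤ unc ν (fun i => p (i + 1)) L := by
      apply unc_le
      intro i hi e
      have hn := nsrc hp (i := i + 1) (by omega) (by omega)
      have h1 := hν2 (p (i+1)) (fun e => hn (e ▸ hs0)) (fun e => hn (e ▸ ha))
      rw [← h1]
      exact e
    have hus := unc_shift ν p L
    rw [if_neg hp0] at hus
    have hcard : 2 ≤ B.card := by
      rw [← card_pair hp0.symm]
      apply card_le_card
      intro v hv
      simp only [mem_insert, mem_singleton] at hv
      rcases hv with rfl | rfl
      · exact b1
      · exact b2
    refine ⟨M + 1, x', hx', by omega, ?_⟩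
    rw [hF, min_eq_left hcard]
    omega

theorem core2 [Fintype α] [DecidableEq α] {prec : α → α → Prop}
    (ht : ∀ a b c, prec a b → prec b c → prec a c) (hirr : ∀ i, ¬ prec i i) {V : Finset α}
    (IH : ∀ W, W ⊂ V → TT prec W) {L : ℕ} {p : ℕ → α}
    (hp : IsCh prec V L p) (hno : ∀ q, ¬ IsCh prec V (L + 1) q) (hL : 0 < L)
    {ν : α → α} (hM : IsM prec V ν) (hp0 : ν (p 0) ≠ p 0) :
    Good prec V (supp ν).card (unc ν p L) := by
  classical
  by_cases ha : Src prec V (ν (p 0))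
  · exact core2a ht hirr IH hp hno hL _ hM hp0 ha rfl
  have hs0 := head_src ht hp hno hL
  haveI : IsTrans α prec := ⟨ht⟩
  haveI : Std.Irrefl prec := ⟨hirr⟩
  have wf : WellFounded prec := Finite.wellFounded_of_trans_of_irrefl prec
  have hpa := (hM.2 _ hp0).2
  obtain ⟨d, ⟨hd1, hd2, hd3⟩, hmin⟩ := wf.has_min
    {d | ¬ Src prec V d ∧ (d = ν (p 0) ∨ prec d (ν (p 0))) ∧ Src prec V (ν d)}
    ⟨ν (p 0), ha, Or.inl rfl, by rw [hM.1]; exact hs0⟩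
  have hdn : ν d ≠ d := fun e => hd1 (e ▸ hd3)
  obtain ⟨hdV, hdc⟩ := hM.2 d hdn
  obtain ⟨e, he, hed⟩ := src_below ht hirr hdV hd1
  have hea : prec e (ν (p 0)) := by
    rcases hd2 with h | h
    · exact h ▸ hed
    · exact ht _ _ _ hed h
  have hep : e ≠ p 0 := fun h => hpa.2.1 (h ▸ hea)
  have hec : e ≠ ν d := fun h => hdc.2.2 (h ▸ hed)
  have hdp : ∀ i, i < L → p i ≠ d := by
    intro i hi h
    rcases Nat.eq_zero_or_pos i with rfl | h0
    · exact hd1 (h ▸ hs0)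
    · have h1 := hp.2 0 i h0 hi
      rw [h] at h1
      rcases hd2 with h2 | h2
      · exact hpa.2.1 (h2 ▸ h1)
      · exact hpa.2.1 (ht _ _ _ h1 h2)
  have finish : ∀ ν' : α → α, IsM prec V ν' → ν' (ν d) = e → ν' e = ν d →
      (supp ν').card = (supp ν).card → unc ν' p L ≤ unc ν p L →
      Good prec V (supp ν).card (unc ν p L) := by
    intro ν' hM' h1 h1' h2 h3
    by_cases hc : ν d = p 0
    · refine (core2a ht hirr IH hp hno hL _ hM' ?_ ?_ rfl).mono (by omega) (by omega)
      · rw [← hc, h1]; exact hec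
      · rw [← hc, h1]; exact he
    · exact (core0 IH hp hno hM' hd3 he h1 hec.symm hc hep).mono (by omega) (by omega)
  obtain ⟨ν1, hM1, a1, a2, a3, a4⟩ := add_pair hM hd3.1 he.1 (src_indep hd3 he hec.symm)
  have hdc' : d ≠ ν d := hdn.symm
  have hde : d ≠ e := fun h => hirr e (by rw [h] at hed; exact hed)
  have hνd : ν (ν d) = d := hM.1 d
  by_cases hef : ν e = e
  · apply finish ν1 hM1 a1 a2
    · have hsup : insert d (supp ν1) = insert e (supp ν) := by
        ext v
        simp only [supp, mem_insert, mem_filter, mem_univ, true_and]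
        by_cases v1 : v = ν d
        · subst v1; rw [a1, hνd]; simp [hec, hdc']
        by_cases v2 : v = e
        · subst v2; simp [a2, hec.symm]
        by_cases v3 : v = d
        · subst v3; simp [hdn]
        have w1 : ν v ≠ ν d := fun h => v3 (by rw [← hM.1 v, h, hM.1])
        have w2 : ν v ≠ e := fun h => v2 (by rw [← hM.1 v, h, hef])
        rw [a3 v v1 v2 w1 w2]; simp [v2, v3]
      have hd' : d ∉ supp ν1 := by
        simp [supp, a4 d hdc' hde (Or.inl rfl)]
      have he' : e ∉ supp ν := by simp [supp, hef]
      have := congrArg card hsup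
      rw [card_insert_of_notMem hd', card_insert_of_notMem he'] at this
      omega
    · apply unc_le
      intro i hi h
      by_cases v1 : p i = ν d
      · rw [v1, a1] at h; exact absurd h hec
      by_cases v2 : p i = e
      · rw [v2, hef]
      have v3 := hdp i hi
      have w1 : ν (p i) ≠ ν d := fun h => v3 (by rw [← hM.1 (p i), h, hM.1])
      have w2 : ν (p i) ≠ e := fun h => v2 (by rw [← hM.1 (p i), h, hef])
      rw [← a3 _ v1 v2 w1 w2, h]
  · by_cases hf : Src prec V (ν e)
    · refine core0 IH hp hno hM he hf rfl (Ne.symm hef) hep ?_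
      intro h
      have : e = ν (p 0) := by rw [← h, hM.1]
      rw [← this] at hea
      exact hirr _ hea
    · have hefi := (hM.2 e hef).2
      have hfd : ν e ≠ d := fun h => hec (by rw [← h, hM.1])
      have hfc : ν e ≠ ν d := fun h => hde (by rw [← hM.1 d, ← h, hM.1])
      have hνe : ν (ν e) = e := hM.1 e
      have hind : IndepJobs prec d (ν e) := by
        refine ⟨hfd.symm, fun h => hefi.2.1 (ht _ _ _ hed h), fun h => ?_⟩
        refine hmin (ν e) ⟨hf, Or.inr ?_, by rw [hνe]; exact he⟩ h
        rcases hd2 with h2 | h2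
        · exact h2 ▸ h
        · exact ht _ _ _ h h2
      have hfV : ν e ∈ V := (hM.2 (ν e) (by rw [hνe]; exact Ne.symm hef)).1
      obtain ⟨ν2, hM2, b1, b2, b3, b4⟩ := add_pair hM1 hdV hfV hind
      have hν2c : ν2 (ν d) = e := by
        rw [b3 _ hdn hfc.symm (by rw [a1]; exact hde.symm) (by rw [a1]; exact Ne.symm hef), a1]
      have hν2e : ν2 e = ν d := by
        rw [b3 _ hde.symm (Ne.symm hef) (by rw [a2]; exact hdn) (by rw [a2]; exact hfc.symm), a2]
      have hoth : ∀ v, v ≠ ν d → v ≠ e → v ≠ d → v ≠ ν e → ν2 v = ν v := by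
        intro v v1 v2 v3 v4
        have hv := hM.1 v
        have h1 : ν1 v = ν v := a3 v v1 v2 (by grind) (by grind)
        rw [b3 v v3 v4 (by grind) (by grind), h1]
      have hiff : ∀ v, ν2 v = v ↔ ν v = v := by
        intro v
        by_cases v1 : v = ν d
        · subst v1; rw [hν2c, hνd]; exact ⟨fun h => absurd h hec, fun h => absurd h hdc'⟩
        by_cases v2 : v = e
        · subst v2; rw [hν2e]; exact ⟨fun h => absurd h hec.symm, fun h => absurd h hef⟩
        by_cases v3 : v = d
        · subst v3; rw [b1]; exact ⟨fun h => absurd h hfd, fun h => absurd h hdn⟩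
        by_cases v4 : v = ν e
        · subst v4; rw [b2, hνe]; exact ⟨fun h => absurd h hfd.symm, fun h => absurd h (Ne.symm hef)⟩
        rw [hoth v v1 v2 v3 v4]
      apply finish ν2 hM2 hν2c hν2e
      · congr 1
        ext v
        simp [supp, hiff]
      · exact unc_le (fun i hi h => (hiff _).1 h)

theorem main_TT [Fintype α] [DecidableEq α] {prec : α → α → Prop}
    (ht : ∀ a b c, prec a b → prec b c → prec a c) (hirr : ∀ i, ¬ prec i i) (V : Finset α) :
    TT prec V := by
  classical
  induction V using Finset.strongInduction with
  | _ V IH =>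
  intro L p ν hp hno hM
  rcases Nat.eq_zero_or_pos L with rfl | hL
  · have hV : V = ∅ := by
      by_contra h
      obtain ⟨v, hv⟩ := Finset.nonempty_iff_ne_empty.2 h
      exact hno (fun _ => v) ⟨fun i hi => hv, fun i j hij hj => by omega⟩
    have hs : supp ν = ∅ := by
      rw [supp, filter_eq_empty_iff]
      intro v _ h
      have := (hM.2 v h).1
      simp [hV] at this
    refine ⟨0, fun _ => 0, ⟨?_, ?_⟩, ?_, ?_⟩
    · simp [hV]
    · simp [hV]
    · simp
    · simp [hs]
  generalize hn : unc ν p L = n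
  induction n using Nat.strong_induction_on generalizing ν with
  | _ n ih =>
  subst hn
  by_cases hp0 : ν (p 0) = p 0
  swap
  · exact core2 ht hirr IH hp hno hL hM hp0
  by_cases hb : ∃ c, IsCh prec V L c ∧ ν (c 0) ≠ c 0
  · obtain ⟨c, hc, hc0⟩ := hb
    obtain ⟨ν', hM', h1, h2, h3⟩ := improve ht hirr hp hc hno hM hL hp0 hc0
    exact (ih _ h3 ν' hM' rfl).mono h1 h2
  push Not at hb
  have hs0 := head_src ht hp hno hL
  obtain ⟨L, rfl⟩ : ∃ L', L = L' + 1 := ⟨L - 1, by omega⟩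
  let B := V.filter (fun v => Src prec V v ∧ ν v = v)
  have mB : ∀ v, v ∈ B ↔ Src prec V v ∧ ν v = v := by
    intro v
    simp only [B, mem_filter, and_iff_right_iff_imp]
    exact fun h => h.1.1
  have b1 : p 0 ∈ B := (mB _).2 ⟨hs0, hp0⟩
  have hsub : V \ B ⊂ V := by
    refine ⟨sdiff_subset, fun h => ?_⟩
    have := h hs0.1
    simp [b1] at this
  obtain ⟨M, x, hx, k1, k2⟩ := IH _ hsub L (fun i => p (i + 1)) ν
    (shift_ch hirr hp (fun b hb => ((mB b).1 hb).1)) (by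
      intro q hq
      have hq' := ch_mono sdiff_subset hq
      have hq0 := head_src ht hq' hno hL
      have h1 : q 0 ∉ B := by
        have := hq.1 0 hL
        simp at this
        exact this.2
      exact h1 ((mB _).2 ⟨hq0, hb q hq'⟩))
    ⟨hM.1, fun v hv => ⟨by
      simp only [mem_sdiff, mB]
      exact ⟨(hM.2 v hv).1, fun h => hv h.2⟩, (hM.2 v hv).2⟩⟩
  obtain ⟨x', hx', hF⟩ := step_block (B := B) (fun b hb => ((mB b).1 hb).1) hx
  have hus := unc_shift ν p L
  rw [if_pos hp0] at hus
  have hcard : 1 ≤ B.card := card_pos.2 ⟨_, b1⟩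
  refine ⟨M + 1, x', hx', by omega, ?_⟩
  rw [hF]
  omega

end RL

namespace RL

variable {α : Type*}

theorem mem_supp [Fintype α] [DecidableEq α] {ν : α → α} {v : α} : v ∈ supp ν ↔ ν v ≠ v := by
  simp [supp]

theorem add_free [Fintype α] [DecidableEq α] {prec : α → α → Prop} {V : Finset α} {ν : α → α}
    (h : IsM prec V ν) {a b : α} (ha : a ∈ V) (hb : b ∈ V) (hab : IndepJobs prec a b)
    (hνa : ν a = a) (hνb : ν b = b) :
    ∃ ν', IsM prec V ν' ∧ ν' a = b ∧ ν' b = a ∧ (∀ v, v ≠ a → v ≠ b → ν' v = ν v) ∧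
      (supp ν').card = (supp ν).card + 2 := by
  obtain ⟨ν', h1, h2, h3, h4, h5⟩ := add_pair h ha hb hab
  have h6 : ∀ v, v ≠ a → v ≠ b → ν' v = ν v := by
    intro v va vb
    apply h4 v va vb
    · intro e
      have := h.1 v
      rw [e, hνa] at this
      exact va this.symm
    · intro e
      have := h.1 v
      rw [e, hνb] at this
      exact vb this.symm
  refine ⟨ν', h1, h2, h3, h6, ?_⟩
  have hs : supp ν' = insert a (insert b (supp ν)) := by
    ext v
    simp only [mem_insert, mem_supp]
    by_cases va : v = a
    · subst va
      simp [h2, hab.1.symm]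
    · by_cases vb : v = b
      · subst vb
        simp [h3, hab.1]
      · simp [va, vb, h6 v va vb]
  rw [hs, card_insert_of_notMem, card_insert_of_notMem]
  · simp [mem_supp, hνb]
  · simp [mem_supp, hνa, hab.1]

theorem IsM.mono {prec : α → α → Prop} {V W : Finset α} (hVW : V ⊆ W) {ν : α → α}
    (h : IsM prec V ν) : IsM prec W ν := ⟨h.1, fun v hv => ⟨hVW (h.2 v hv).1, (h.2 v hv).2⟩⟩

theorem augment [Fintype α] [DecidableEq α] {prec : α → α → Prop} (V : Finset α) :
    ∀ ν μ : α → α, IsM prec V ν → IsM prec V μ → (supp ν).card < (supp μ).card →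
    ∃ ν', IsM prec V ν' ∧ supp ν ⊆ supp ν' ∧ (supp ν').card = (supp ν).card + 2 := by
  induction V using Finset.strongInduction with
  | _ V IH =>
  intro ν μ hν hμ hlt
  obtain ⟨v, hvμ, hvν⟩ := Finset.exists_mem_notMem_of_card_lt_card hlt
  rw [mem_supp] at hvμ
  rw [mem_supp, not_not] at hvν
  obtain ⟨hvV, hind⟩ := hμ.2 v hvμ
  have hwμ : μ (μ v) ≠ μ v := by rw [hμ.1]; exact hvμ.symm
  have hwV := (hμ.2 _ hwμ).1
  generalize hw : μ v = w at *
  by_cases hνw : ν w = w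
  · obtain ⟨ν', h1, h2, h3, h4, h5⟩ := add_free hν hvV hwV hind hvν hνw
    refine ⟨ν', h1, ?_, h5⟩
    intro u hu
    rw [mem_supp] at hu ⊢
    rw [h4 u (fun e => hu (e ▸ hvν)) (fun e => hu (e ▸ hνw))]
    exact hu
  · have hindwz := (hν.2 w hνw).2
    have hzw : ν (ν w) = w := hν.1 w
    have hzV := (hν.2 (ν w) (by rw [hzw]; exact fun e => hνw e.symm)).1
    generalize hz : ν w = z at *
    have hzv : z ≠ v := by
      rintro rfl
      rw [hvν] at hzw
      exact hvμ hzw.symm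
    obtain ⟨μ', hμ', -, hμc⟩ := del_pair hμ hw hvμ.symm {v, w} (by simp) (by simp)
      (by intro u hu; simp at hu; grind)
    obtain ⟨ν1, hν1, hν1e, hν1c⟩ := del_pair hν hz (Ne.symm hνw) {v, w, z} (by simp) (by simp)
      (by intro u hu; simp at hu; grind)
    have hsub : V \ {v, w} ⊂ V := by
      refine ⟨sdiff_subset, fun h => ?_⟩
      have := h hvV
      simp at this
    obtain ⟨N, hN, hsN, hNc⟩ := IH _ hsub ν1 μ' (hν1.mono (by intro u; simp; tauto)) hμ' (by omega)
    have hNv : N v = v := by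
      by_contra h
      have := (hN.2 v h).1
      simp at this
    have hNw : N w = w := by
      by_contra h
      have := (hN.2 w h).1
      simp at this
    have hNV : IsM prec V N := hN.mono sdiff_subset
    have key : ∀ u, ν u ≠ u → u ≠ w → u ≠ z → N u ≠ u := by
      intro u h1 h2 h3
      have : u ∈ supp ν1 := by rw [mem_supp, hν1e u h2 h3]; exact h1
      exact mem_supp.1 (hsN this)
    by_cases hNz : N z = z
    · obtain ⟨ν', h1, h2, h3, h4, h5⟩ := add_free hNV hwV hzV hindwz hNw hNz
      refine ⟨ν', h1, ?_, by omega⟩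
      intro u hu
      rw [mem_supp] at hu ⊢
      by_cases uw : u = w
      · rw [uw, h2]; exact hνw
      · by_cases uz : u = z
        · rw [uz, h3]; exact fun e => hνw e.symm
        · rw [h4 u uw uz]; exact key u hu uw uz
    · obtain ⟨ν', h1, h2, h3, h4, h5⟩ := add_free hNV hvV hwV hind hNv hNw
      refine ⟨ν', h1, ?_, by omega⟩
      intro u hu
      rw [mem_supp] at hu ⊢
      by_cases uw : u = w
      · rw [uw, h3]; exact hvμ.symm
      · by_cases uv : u = v
        · rw [uv, h2]; exact hvμ
        · rw [h4 u uv uw]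
          by_cases uz : u = z
          · rw [uz]; exact hNz
          · exact key u hu uw uz

theorem augment_to [Fintype α] [DecidableEq α] {prec : α → α → Prop} (V : Finset α)
    {ν μ : α → α} (hν : IsM prec V ν) (hμ : IsM prec V μ) (k : ℕ)
    (hk : (supp ν).card + 2 * k ≤ (supp μ).card) :
    ∃ ν', IsM prec V ν' ∧ supp ν ⊆ supp ν' ∧ (supp ν').card = (supp ν).card + 2 * k := by
  induction k with
  | zero => exact ⟨ν, hν, Subset.refl _, by simp⟩
  | succ k ih =>
    obtain ⟨ν1, h1, h2, h3⟩ := ih (by omega)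
    obtain ⟨ν2, h4, h5, h6⟩ := augment V ν1 μ h1 hμ (by omega)
    exact ⟨ν2, h4, h2.trans h5, by omega⟩

theorem of_pairs [Fintype α] [DecidableEq α] {prec : α → α → Prop} {R : α → α → Prop}
    (hR : ∀ a b, R a b → IndepJobs prec a b) (pairs : Finset (α × α)) :
    IsMatching R pairs → ∃ ν, IsM prec univ ν ∧ (∀ e ∈ pairs, ν e.1 = e.2) ∧
      (∀ v, ν v ≠ v → ∃ e ∈ pairs, v = e.1 ∨ v = e.2) ∧ (supp ν).card = 2 * pairs.card := by
  induction pairs using Finset.induction_on with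
  | empty =>
    intro _
    refine ⟨id, ⟨fun _ => rfl, fun v hv => absurd rfl hv⟩, by simp, fun v hv => absurd rfl hv, ?_⟩
    simp [supp]
  | insert e S he ih =>
    intro hm
    obtain ⟨ν, h1, h2, h3, h4⟩ := ih ⟨fun f hf => hm.1 f (mem_insert_of_mem hf),
      fun f hf g hg => hm.2 f (mem_insert_of_mem hf) g (mem_insert_of_mem hg)⟩
    have hd : ∀ f ∈ S, _ := fun f hf => hm.2 e (mem_insert_self _ _) f (mem_insert_of_mem hf)
      (fun h => he (h ▸ hf))
    have f1 : ν e.1 = e.1 := by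
      by_contra h
      obtain ⟨f, hf, h⟩ := h3 _ h
      have := hd f hf
      tauto
    have f2 : ν e.2 = e.2 := by
      by_contra h
      obtain ⟨f, hf, h⟩ := h3 _ h
      have := hd f hf
      tauto
    obtain ⟨ν', g1, g2, g3, g4, g5⟩ := add_free h1 (mem_univ e.1) (mem_univ e.2)
      (hR _ _ (hm.1 e (mem_insert_self _ _))) f1 f2
    refine ⟨ν', g1, ?_, ?_, ?_⟩
    · intro f hf
      rcases mem_insert.1 hf with rfl | hf
      · exact g2
      · have := hd f hf
        rw [g4 _ this.1.symm this.2.2.1.symm]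
        exact h2 f hf
    · intro v hv
      by_cases v1 : v = e.1
      · exact ⟨e, mem_insert_self _ _, Or.inl v1⟩
      · by_cases v2 : v = e.2
        · exact ⟨e, mem_insert_self _ _, Or.inr v2⟩
        · rw [g4 v v1 v2] at hv
          obtain ⟨f, hf, h⟩ := h3 v hv
          exact ⟨f, mem_insert_of_mem hf, h⟩
    · rw [g5, h4, card_insert_of_notMem he]
      ring

end RL

namespace RL

variable {α : Type*}

theorem sum_loads [Fintype α] [DecidableEq α] {M : ℕ} {x : α → ℕ} (hx : ∀ i, x i < M) :
    ∑ τ ∈ range M, (univ.filter (fun i => x i = τ)).card = Fintype.card α := by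
  rw [← card_univ, eq_comm]
  exact card_eq_sum_card_fiberwise (fun i _ => by simpa using hx i)

theorem FV_le_card [Fintype α] [DecidableEq α] {M : ℕ} {x : α → ℕ} (hx : ∀ i, x i < M) :
    FV univ M x ≤ Fintype.card α := by
  rw [← sum_loads hx]
  exact sum_le_sum (fun τ _ => min_le_right _ _)

theorem split_step [Fintype α] [DecidableEq α] {prec : α → α → Prop} {M : ℕ} {x : α → ℕ}
    (hx : Sch prec univ M x) (hlt : FV univ M x < Fintype.card α) :
    ∃ x', Sch prec univ (M + 1) x' ∧ FV univ M x + 1 ≤ FV univ (M + 1) x' := by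
  have hxM : ∀ i, x i < M := fun i => hx.2 i (mem_univ i)
  rw [← sum_loads hxM] at hlt
  obtain ⟨τ, hτ, hlt⟩ := exists_lt_of_sum_lt hlt
  rw [mem_range] at hτ
  have h3 : 3 ≤ (univ.filter (fun i => x i = τ)).card := by
    by_contra h
    rw [min_eq_right (by omega)] at hlt
    exact lt_irrefl _ hlt
  obtain ⟨j, hj⟩ := card_pos.1 (by omega : 0 < (univ.filter (fun i => x i = τ)).card)
  have hjτ : x j = τ := (mem_filter.1 hj).2
  let x' : α → ℕ := fun i => if x i ≤ τ ∧ i ≠ j then x i else x i + 1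
  have ex' : ∀ i, x' i = if x i ≤ τ ∧ i ≠ j then x i else x i + 1 := fun i => rfl
  let φ : ℕ → ℕ := fun t => if t ≤ τ then t else t + 1
  have eφ : ∀ t, φ t = if t ≤ τ then t else t + 1 := fun i => rfl
  refine ⟨x', ⟨?_, ?_⟩, ?_⟩
  · intro i hi k hk hik
    have := hx.1 i hi k hk hik
    rw [ex', ex']
    grind
  · intro i hi
    have := hxM i
    rw [ex']
    split_ifs <;> omega
  · let g : ℕ → ℕ := fun t => min 2 (univ.filter (fun i => x' i = t)).card
    have hτ1 : τ + 1 ∈ range (M + 1) := by simp; omega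
    have hF' : FV univ (M + 1) x' = g (τ + 1) + ∑ t ∈ (range (M + 1)).erase (τ + 1), g t :=
      (add_sum_erase (range (M + 1)) g hτ1).symm
    have hg1 : 1 ≤ g (τ + 1) := by
      have : 0 < (univ.filter (fun i => x' i = τ + 1)).card :=
        card_pos.2 ⟨j, by simp [ex', hjτ]⟩
      simp only [g]
      omega
    have hinj : Set.InjOn φ (range M : Finset ℕ) := by
      intro s _ t _ h
      rw [eφ, eφ] at h
      split_ifs at h <;> omega
    have himg : (range M).image φ ⊆ (range (M + 1)).erase (τ + 1) := by
      intro s hs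
      obtain ⟨t, ht, rfl⟩ := mem_image.1 hs
      rw [mem_range] at ht
      rw [mem_erase, mem_range, eφ]
      split_ifs <;> omega
    have hle : FV univ M x ≤ ∑ t ∈ range M, g (φ t) := by
      apply sum_le_sum
      intro t _
      by_cases htτ : t = τ
      · subst htτ
        have hs : (univ.filter (fun i => x i = t)).erase j ⊆ univ.filter (fun i => x' i = φ t) := by
          intro i hi
          simp only [mem_erase, mem_filter, mem_univ, true_and] at hi ⊢
          rw [ex', eφ]
          simp [hi.1, hi.2]
        have := card_le_card hs
        rw [card_erase_of_mem hj] at this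
        simp only [g]
        omega
      · have hs : (univ.filter (fun i => x i = t)) ⊆ univ.filter (fun i => x' i = φ t) := by
          intro i hi
          simp only [mem_filter, mem_univ, true_and] at hi ⊢
          rw [ex', eφ]
          grind
        have := card_le_card hs
        simp only [g]
        omega
    rw [← sum_image hinj] at hle
    have := sum_le_sum_of_subset (f := g) himg
    omega

/-- longer horizon -/
theorem extend_sched [Fintype α] [DecidableEq α] {prec : α → α → Prop} {M m : ℕ} {x : α → ℕ}
    (hx : Sch prec univ M x) (hF : M + m ≤ FV univ M x) (k : ℕ) :
    ∃ x', Sch prec univ (M + k) x' ∧ min (Fintype.card α) (M + k + m) ≤ FV univ (M + k) x' := by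
  induction k with
  | zero => exact ⟨x, hx, by simp only [add_zero]; omega⟩
  | succ k ih =>
    obtain ⟨x1, h1, h2⟩ := ih
    by_cases h : FV univ (M + k) x1 < Fintype.card α
    · obtain ⟨x2, h3, h4⟩ := split_step h1 h
      exact ⟨x2, h3, by rw [← add_assoc]; omega⟩
    · refine ⟨x1, ⟨h1.1, fun i hi => by have := h1.2 i hi; omega⟩, ?_⟩
      have : FV univ (M + k) x1 ≤ FV univ (M + (k + 1)) x1 := by
        unfold FV
        apply sum_le_sum_of_subset
        intro t
        simp
        omega
      omega

theorem pairs_of_steps [DecidableEq α] {R : α → α → Prop} {x : α → ℕ} (S : Finset ℕ)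
    (h : ∀ τ ∈ S, ∃ a b, x a = τ ∧ x b = τ ∧ R a b) :
    ∃ pairs : Finset (α × α), IsMatching R pairs ∧ pairs.card = S.card := by
  classical
  rcases S.eq_empty_or_nonempty with rfl | ⟨τ0, h0⟩
  · exact ⟨∅, ⟨by simp, by simp⟩, by simp⟩
  · obtain ⟨a0, -⟩ := h τ0 h0
    have : ∀ τ, ∃ e : α × α, τ ∈ S → x e.1 = τ ∧ x e.2 = τ ∧ R e.1 e.2 := by
      intro τ
      by_cases hτ : τ ∈ S
      · obtain ⟨a, b, h⟩ := h τ hτ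
        exact ⟨(a, b), fun _ => h⟩
      · exact ⟨(a0, a0), fun h => absurd h hτ⟩
    choose f hf using this
    refine ⟨S.image f, ⟨?_, ?_⟩, ?_⟩
    · intro e he
      obtain ⟨τ, hτ, rfl⟩ := mem_image.1 he
      exact (hf τ hτ).2.2
    · intro e he e' he' hne
      obtain ⟨τ, hτ, rfl⟩ := mem_image.1 he
      obtain ⟨σ, hσ, rfl⟩ := mem_image.1 he'
      have hτσ : τ ≠ σ := fun h => hne (h ▸ rfl)
      have h1 := hf τ hτ
      have h2 := hf σ hσ
      refine ⟨?_, ?_, ?_, ?_⟩ <;> intro e <;> apply hτσ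
      · rw [← h1.1, ← h2.1, e]
      · rw [← h1.1, ← h2.2.1, e]
      · rw [← h1.2.1, ← h2.1, e]
      · rw [← h1.2.1, ← h2.2.1, e]
    · apply card_image_of_injOn
      intro τ hτ σ hσ e
      rw [← (hf τ hτ).1, ← (hf σ hσ).1]
      rw [e]

theorem ub_star [Fintype α] [DecidableEq α] {prec : α → α → Prop} {M : ℕ} {x : α → ℕ}
    (hx : Sch prec univ M x) {m : ℕ}
    (hm : ∀ pairs : Finset (α × α), IsMatching (IndepJobs prec) pairs → pairs.card ≤ m) :
    FV univ M x ≤ M + m := by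
  let S := (range M).filter (fun τ => 2 ≤ (univ.filter (fun i => x i = τ)).card)
  obtain ⟨pairs, h1, h2⟩ := pairs_of_steps (R := IndepJobs prec) (x := x) S (by
    intro τ hτ
    obtain ⟨a, ha, b, hb, hab⟩ := one_lt_card.1 (mem_filter.1 hτ).2
    simp only [mem_filter, mem_univ, true_and] at ha hb
    refine ⟨a, b, ha, hb, hab, fun h => ?_, fun h => ?_⟩
    · have := hx.1 a (mem_univ _) b (mem_univ _) h
      omega
    · have := hx.1 b (mem_univ _) a (mem_univ _) h
      omega)
  have h3 := hm _ h1
  have h4 : FV univ M x ≤ ∑ τ ∈ range M,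
      (1 + if 2 ≤ (univ.filter (fun i => x i = τ)).card then 1 else 0) := by
    apply sum_le_sum
    intro τ _
    split_ifs <;> omega
  rw [sum_add_distrib, ← card_filter] at h4
  simp only [sum_const, card_range, smul_eq_mul, mul_one] at h4
  have h5 : S.card ≤ m := h2 ▸ h3
  exact h4.trans (Nat.add_le_add_left h5 M)

theorem ub_path [Fintype α] [DecidableEq α] {prec : α → α → Prop} {M : ℕ} {x : α → ℕ}
    (hx : Sch prec univ M x) {m : ℕ} (P : Finset α)
    (hP : ∀ a ∈ P, ∀ b ∈ P, a ≠ b → prec a b ∨ prec b a)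
    (hm : ∀ pairs : Finset (α × α),
      IsMatching (fun i j => i ∈ P ∧ j ∉ P ∧ IndepJobs prec i j) pairs → pairs.card ≤ m) :
    P.card ≤ M ∧ FV univ M x ≤ 2 * (M - P.card) + P.card + m := by
  have hinj : ∀ a ∈ P, ∀ b ∈ P, x a = x b → a = b := by
    intro a ha b hb e
    by_contra hne
    rcases hP a ha b hb hne with h | h
    · have := hx.1 a (mem_univ _) b (mem_univ _) h
      omega
    · have := hx.1 b (mem_univ _) a (mem_univ _) h
      omega
  let Q := P.image x
  have hQc : Q.card = P.card := card_image_of_injOn (fun a ha b hb => hinj a ha b hb)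
  have hQs : Q ⊆ range M := by
    intro t ht
    obtain ⟨a, ha, rfl⟩ := mem_image.1 ht
    exact mem_range.2 (hx.2 a (mem_univ _))
  have hQM : Q.card ≤ M := by simpa using card_le_card hQs
  let S := Q.filter (fun τ => 2 ≤ (univ.filter (fun i => x i = τ)).card)
  obtain ⟨pairs, h1, h2⟩ := pairs_of_steps
    (R := fun i j => i ∈ P ∧ j ∉ P ∧ IndepJobs prec i j) (x := x) S (by
    intro τ hτ
    obtain ⟨hq, hc⟩ := mem_filter.1 hτ
    obtain ⟨a, ha, rfl⟩ := mem_image.1 hq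
    obtain ⟨b, hb, hab⟩ := exists_mem_ne (show 1 < _ from hc) a
    simp only [mem_filter, mem_univ, true_and] at hb
    refine ⟨a, b, rfl, hb, ha, fun h => hab (hinj b h a ha hb), hab.symm, fun h => ?_, fun h => ?_⟩
    · have := hx.1 a (mem_univ _) b (mem_univ _) h
      omega
    · have := hx.1 b (mem_univ _) a (mem_univ _) h
      omega)
  have h3 := hm _ h1
  have h4 : ∑ τ ∈ Q, min 2 (univ.filter (fun i => x i = τ)).card ≤ ∑ τ ∈ Q,
      (1 + if 2 ≤ (univ.filter (fun i => x i = τ)).card then 1 else 0) := by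
    apply sum_le_sum
    intro τ _
    split_ifs <;> omega
  rw [sum_add_distrib, ← card_filter] at h4
  simp only [sum_const, smul_eq_mul, mul_one] at h4
  have h5 : S.card ≤ m := h2 ▸ h3
  have h6 : ∑ τ ∈ range M \ Q, min 2 (univ.filter (fun i => x i = τ)).card ≤
      ∑ τ ∈ range M \ Q, 2 := sum_le_sum (fun τ _ => min_le_left _ _)
  rw [sum_const, card_sdiff_of_subset hQs, card_range, smul_eq_mul] at h6
  have h7 : FV univ M x = _ := (sum_sdiff (f := fun τ => min 2 (univ.filter (fun i => x i = τ)).card)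
    hQs).symm
  rw [hQc] at h4 h6 hQM
  have h8 := h4.trans (Nat.add_le_add_left h5 _)
  refine ⟨hQM, ?_⟩
  rw [h7]
  omega

end RL

namespace RL

variable {α : Type*}

theorem lower [Fintype α] [DecidableEq α] {prec : α → α → Prop}
    (ht : ∀ a b c, prec a b → prec b c → prec a c) (hirr : ∀ i, ¬ prec i i)
    (P : List α) (hcrit : IsCriticalPath prec P) (mP : ℕ)
    (hmP : IsMaxMatchingSize (fun i j => i ∈ P ∧ j ∉ P ∧ IndepJobs prec i j) mP)
    (mstar : ℕ) (hmstar : IsMaxMatchingSize (IndepJobs prec) mstar)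
    (k : ℕ) (hk : mP + k ≤ mstar) :
    2 * k + P.length + mP ≤ Fintype.card α ∧ ∀ M, P.length + k ≤ M →
      ∃ x, Sch prec univ M x ∧ min (Fintype.card α) (M + mP + k) ≤ FV univ M x := by
  rcases isEmpty_or_nonempty α with hemp | ⟨⟨a0⟩⟩
  · have hP : P = [] := List.eq_nil_iff_forall_not_mem.2 (fun a => isEmptyElim a)
    obtain ⟨pairs, -, rfl⟩ := hmstar.1
    rw [Finset.eq_empty_of_isEmpty pairs, card_empty] at hk
    have h1 : mP = 0 := by omega
    have h2 : k = 0 := by omega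
    subst h1 h2 hP
    refine ⟨by simp, fun M _ => ⟨fun _ => 0, ⟨fun i => isEmptyElim i, fun i => isEmptyElim i⟩, ?_⟩⟩
    simp
  · haveI : IsTrans α prec := ⟨ht⟩
    obtain ⟨hch, hnd, hmax⟩ := hcrit
    have hpw : P.Pairwise prec := List.isChain_iff_pairwise.1 hch
    let p : ℕ → α := fun i => P.getD i a0
    have ep : ∀ i (h : i < P.length), p i = P[i] := fun i h => by simp [p, h]
    have hp : IsCh prec univ P.length p := by
      refine ⟨fun _ _ => mem_univ _, fun i j hij hj => ?_⟩
      rw [ep i (by omega), ep j hj]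
      exact List.pairwise_iff_getElem.1 hpw i j _ _ hij
    have hno : ∀ q, ¬ IsCh prec univ (P.length + 1) q := by
      intro q hq
      have hpq : ((List.range (P.length + 1)).map q).Pairwise prec := by
        rw [List.pairwise_map]
        refine List.Pairwise.imp_of_mem ?_ List.pairwise_lt_range
        intro a b _ hb hab
        exact hq.2 a b hab (List.mem_range.1 hb)
      have := hmax _ hpq.isChain (hpq.imp (fun {a b} h => fun e => hirr a (by rw [← e] at h; exact h)))
      simp at this
    have hmem : ∀ a, a ∈ P ↔ ∃ i, i < P.length ∧ p i = a := by
      intro a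
      rw [List.mem_iff_getElem]
      constructor
      · rintro ⟨i, hi, rfl⟩
        exact ⟨i, hi, ep i hi⟩
      · rintro ⟨i, hi, rfl⟩
        exact ⟨i, hi, (ep i hi).symm⟩
    have hcomp : ∀ a ∈ P, ∀ b ∈ P, ¬ IndepJobs prec a b := by
      intro a ha b hb h
      obtain ⟨i, hi, rfl⟩ := (hmem a).1 ha
      obtain ⟨j, hj, rfl⟩ := (hmem b).1 hb
      rcases lt_trichotomy i j with h1 | h1 | h1
      · exact h.2.1 (hp.2 i j h1 hj)
      · exact h.1 (by rw [h1])
      · exact h.2.2 (hp.2 j i h1 hi)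
    obtain ⟨pairs, hpm, hpc⟩ := hmP.1
    obtain ⟨pairs', hpm', hpc'⟩ := hmstar.1
    obtain ⟨νP, n1, n2, n3, n4⟩ := of_pairs (prec := prec) (fun a b h => h.2.2) pairs hpm
    obtain ⟨μ, m1, m2, m3, m4⟩ := of_pairs (prec := prec) (fun a b h => h) pairs' hpm'
    obtain ⟨ν, hν, hsub, hcard⟩ := augment_to univ n1 m1 k (by omega)
    have hcν : (supp ν).card = 2 * (mP + k) := by omega
    -- covered vertices of the path
    let C := P.toFinset.filter (fun a => ν a ≠ a)
    have hC1 : mP ≤ C.card := by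
      have : (pairs.image Prod.fst).card = pairs.card := by
        apply card_image_of_injOn
        intro e he f hf h
        by_contra hne
        exact (hpm.2 e he f hf hne).1 h
      rw [← hpc, ← this]
      apply card_le_card
      intro a ha
      obtain ⟨e, he, rfl⟩ := mem_image.1 ha
      have h1 := hpm.1 e he
      refine mem_filter.2 ⟨List.mem_toFinset.2 h1.1, mem_supp.1 (hsub (mem_supp.2 ?_))⟩
      rw [n2 e he]
      exact h1.2.2.1.symm
    have hC2 : C.card ≤ mP := by
      have hi : (C.image (fun a => (a, ν a))).card = C.card := by
        apply card_image_of_injective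
        intro a b h
        exact (Prod.ext_iff.1 h).1
      rw [← hi]
      apply hmP.2
      have hC : ∀ a ∈ C, a ∈ P ∧ ν a ≠ a := fun a ha => by
        have := mem_filter.1 ha
        exact ⟨List.mem_toFinset.1 this.1, this.2⟩
      have hnot : ∀ a ∈ C, ν a ∉ P := by
        intro a ha h
        exact hcomp a (hC a ha).1 (ν a) h (hν.2 a (hC a ha).2).2
      constructor
      · intro e he
        obtain ⟨a, ha, rfl⟩ := mem_image.1 he
        exact ⟨(hC a ha).1, hnot a ha, (hν.2 a (hC a ha).2).2⟩
      · intro e he f hf hne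
        obtain ⟨a, ha, rfl⟩ := mem_image.1 he
        obtain ⟨b, hb, rfl⟩ := mem_image.1 hf
        have hab : a ≠ b := fun h => hne (by rw [h])
        refine ⟨hab, fun h => ?_, fun h => ?_, fun h => hab ?_⟩
        · have h' : a = ν b := h
          exact hnot b hb (h' ▸ (hC a ha).1)
        · have h' : ν a = b := h
          exact hnot a ha (h'.symm ▸ (hC b hb).1)
        · have h1 : ν (ν a) = ν (ν b) := congrArg ν h
          rwa [hν.1, hν.1] at h1
    let U := P.toFinset.filter (fun a => ¬ ν a ≠ a)
    have hCU : C.card + U.card = P.length := by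
      rw [← List.toFinset_card_of_nodup hnd]
      exact card_filter_add_card_filter_not (s := P.toFinset) (fun a => ν a ≠ a)
    have hunc : unc ν p P.length = U.card := by
      unfold unc
      have : U = ((range P.length).filter (fun i => ν (p i) = p i)).image p := by
        ext a
        simp only [U, mem_filter, List.mem_toFinset, mem_image, mem_range, not_not, hmem]
        constructor
        · rintro ⟨⟨i, hi, rfl⟩, h⟩
          exact ⟨i, ⟨hi, h⟩, rfl⟩
        · rintro ⟨i, ⟨hi, h⟩, rfl⟩
          exact ⟨⟨i, hi, rfl⟩, h⟩
      rw [this, card_image_of_injOn]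
      intro i hi j hj h
      simp only [coe_filter, mem_range, Set.mem_setOf_eq] at hi hj
      exact hp.inj hirr hi.1 hj.1 h
    have hn : (supp ν).card + U.card ≤ Fintype.card α := by
      rw [← card_union_of_disjoint]
      · exact card_le_univ _
      · rw [disjoint_left]
        intro a ha hb
        exact (mem_filter.1 hb).2 (mem_supp.1 ha)
    obtain ⟨M0, x, hx, g1, g2⟩ := main_TT ht hirr univ P.length p ν hp hno hν
    refine ⟨by omega, fun M hM => ?_⟩
    obtain ⟨x', h1, h2⟩ := extend_sched hx (m := mP + k) (by omega) (M - M0)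
    have e : M0 + (M - M0) = M := by omega
    rw [e] at h1 h2
    exact ⟨x', h1, by rw [add_assoc]; exact h2⟩

theorem greatest_of [Fintype α] [DecidableEq α] {prec : α → α → Prop} {M v : ℕ}
    (hl : ∃ x, Sch prec univ M x ∧ v ≤ FV univ M x)
    (hu : ∀ x, Sch prec univ M x → FV univ M x ≤ v) : IsGreatest (schedVals prec M) v := by
  constructor
  · obtain ⟨x, hx, h⟩ := hl
    exact ⟨x, fun i j hij => hx.1 i (mem_univ _) j (mem_univ _) hij,
      fun i => hx.2 i (mem_univ _), le_antisymm (hu x hx) h⟩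
  · rintro w ⟨x, h1, h2, rfl⟩
    exact hu x ⟨fun i _ j _ h => h1 i j h, fun i _ => h2 i⟩

end RL

/-- The optimal value `F*(M)` of the `L = 2` resource leveling problem as a
piecewise linear function of the makespan deadline `M`. -/
theorem stmt5 {ι : Type*} [Fintype ι] [DecidableEq ι] (prec : ι → ι → Prop)
    (htrans : Transitive prec) (hirr : ∀ i, ¬ prec i i)
    (P : List ι) (hcrit : IsCriticalPath prec P)
    (mP : ℕ)
    (hmP : IsMaxMatchingSize (fun i j => i ∈ P ∧ j ∉ P ∧ IndepJobs prec i j) mP)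
    (mstar : ℕ)
    (hmstar : IsMaxMatchingSize (IndepJobs prec) mstar) :
    (∀ M, P.length ≤ M → M ≤ P.length + (mstar - mP) →
      IsGreatest (schedVals prec M) (2 * (M - P.length) + P.length + mP)) ∧
    (∀ M, P.length + (mstar - mP) ≤ M → M ≤ Fintype.card ι - mstar →
      IsGreatest (schedVals prec M) (M + mstar)) ∧
    (∀ M, Fintype.card ι - mstar ≤ M →
      IsGreatest (schedVals prec M) (Fintype.card ι)) := by
  have ht : ∀ a b c, prec a b → prec b c → prec a c := fun a b c h1 h2 => htrans h1 h2
  have hle : mP ≤ mstar := by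
    obtain ⟨pairs, h1, rfl⟩ := hmP.1
    exact hmstar.2 pairs ⟨fun e he => (h1.1 e he).2.2, h1.2⟩
  have hPt : P.toFinset.card = P.length := List.toFinset_card_of_nodup hcrit.2.1
  have hPc : ∀ a ∈ P.toFinset, ∀ b ∈ P.toFinset, a ≠ b → prec a b ∨ prec b a := by
    haveI : IsTrans ι prec := ⟨ht⟩
    have hpw : P.Pairwise prec := List.isChain_iff_pairwise.1 hcrit.1
    intro a ha b hb hab
    rw [List.mem_toFinset] at ha hb
    obtain ⟨i, hi, rfl⟩ := List.mem_iff_getElem.1 ha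
    obtain ⟨j, hj, rfl⟩ := List.mem_iff_getElem.1 hb
    rcases lt_trichotomy i j with h | h | h
    · exact Or.inl (List.pairwise_iff_getElem.1 hpw i j _ _ h)
    · subst h
      exact absurd rfl hab
    · exact Or.inr (List.pairwise_iff_getElem.1 hpw j i _ _ h)
  have low := fun k hk => RL.lower ht hirr P hcrit mP hmP mstar hmstar k hk
  have ub1 : ∀ M x, RL.Sch prec univ M x → RL.FV univ M x ≤ Fintype.card ι :=
    fun M x hx => RL.FV_le_card (fun i => hx.2 i (mem_univ i))
  have ub2 : ∀ M x, RL.Sch prec univ M x → RL.FV univ M x ≤ M + mstar :=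
    fun M x hx => RL.ub_star hx hmstar.2
  have ub3 : ∀ M x, RL.Sch prec univ M x →
      RL.FV univ M x ≤ 2 * (M - P.length) + P.length + mP := by
    intro M x hx
    have := (RL.ub_path hx P.toFinset hPc (m := mP) (by
      intro pairs hp
      apply hmP.2
      simpa only [List.mem_toFinset] using hp)).2
    rwa [hPt] at this
  refine ⟨fun M h1 h2 => ?_, fun M h1 h2 => ?_, fun M h1 => ?_⟩
  · obtain ⟨hn, hs⟩ := low (M - P.length) (by omega)
    obtain ⟨x, hx, hF⟩ := hs M (by omega)
    exact RL.greatest_of ⟨x, hx, by omega⟩ (ub3 M)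
  · obtain ⟨hn, hs⟩ := low (mstar - mP) (by omega)
    obtain ⟨x, hx, hF⟩ := hs M (by omega)
    exact RL.greatest_of ⟨x, hx, by omega⟩ (ub2 M)
  · obtain ⟨hn, hs⟩ := low (mstar - mP) (by omega)
    obtain ⟨x, hx, hF⟩ := hs M (by omega)
    exact RL.greatest_of ⟨x, hx, by omega⟩ (ub1 M)
end

section
/- Let jobs J be partitioned into J_1 (resource consumption 1) and J_2 (resource consumption 2), with processing times p_i, total p_{J_2} = Σ_{i∈J_2} p_i < M, level L = 2 and makespan deadline M. For any subset J' ⊆ J_1 there exists a feasible schedule x with F(x) ≥ 2·p_{J_2} + min(Σ_{i∈J'} p_i, M − p_{J_2}) + min(Σ_{i∈J_1∖J'} p_i, M − p_{J_2}). -/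
open Finset

variable {ι : Type*}

/-- Jobs with resource consumption 1. -/
def J1set [Fintype ι] (c : ι → ℕ) : Finset ι := univ.filter fun i => c i = 1

/-- Jobs with resource consumption 2. -/
def J2set [Fintype ι] (c : ι → ℕ) : Finset ι := univ.filter fun i => c i = 2

/-- Total processing time of the consumption-2 jobs. -/
def pJ2 [Fintype ι] (p c : ι → ℕ) : ℕ := ∑ i ∈ J2set c, p i

/-- The leveling objective with level `L = 2`: per time step the total resource
consumption of running jobs, capped at 2. -/
def lev2F [Fintype ι] (p c : ι → ℕ) (M : ℕ) (x : ι → ℕ) : ℕ :=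
  ∑ τ ∈ Finset.range M, min 2 (∑ i ∈ univ.filter (fun i => x i ≤ τ ∧ τ < x i + p i), c i)

theorem cover_aux {ι : Type*} [DecidableEq ι] (p : ι → ℕ) (M a : ℕ)
    (hfit : ∀ i, p i ≤ M) (S : Finset ι) :
    ∃ x : ι → ℕ, (∀ i, x i + p i ≤ M) ∧
      ∀ τ, a ≤ τ → τ < M → τ < a + ∑ i ∈ S, p i → ∃ i ∈ S, x i ≤ τ ∧ τ < x i + p i := by
  induction S using Finset.induction_on with
  | empty =>
    refine ⟨fun _ => 0, fun i => by simpa using hfit i, ?_⟩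
    intro τ h1 _ h3
    simp at h3
    omega
  | insert j S hj ih =>
    obtain ⟨x, hx, hcov⟩ := ih
    refine ⟨fun i => if i = j then min (a + ∑ i ∈ S, p i) (M - p j) else x i, ?_, ?_⟩
    · intro i
      have := hfit i
      by_cases h : i = j
      · subst h
        simp only [if_true]
        omega
      · simpa [h] using hx i
    · intro τ h1 h2 h3
      rw [Finset.sum_insert hj] at h3
      by_cases h : τ < a + ∑ i ∈ S, p i
      · obtain ⟨i, hi, hh⟩ := hcov τ h1 h2 h
        have hij : i ≠ j := fun e => hj (e ▸ hi)
        exact ⟨i, Finset.mem_insert_of_mem hi, by simpa [hij] using hh⟩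
      · refine ⟨j, Finset.mem_insert_self _ _, ?_⟩
        have := hfit j
        simp only [if_true]
        omega

theorem sum_ind_aux (M a b k : ℕ) (h : a + b ≤ M) :
    ∑ τ ∈ Finset.range M, (if a ≤ τ ∧ τ < a + b then k else 0) = b * k := by
  rw [← Finset.sum_filter, Finset.sum_const, smul_eq_mul]
  congr 1
  have : (Finset.range M).filter (fun τ => a ≤ τ ∧ τ < a + b) = Finset.Ico a (a + b) := by
    ext τ
    simp only [Finset.mem_filter, Finset.mem_range, Finset.mem_Ico]
    omega
  rw [this]
  simp

/-- Constructive lower bound for `L2 | C_max ≤ M | F`: for any subset `J' ⊆ J₁`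
there is a feasible schedule `x` with
`F(x) ≥ 2·p_{J₂} + min(Σ_{J'} p, M − p_{J₂}) + min(Σ_{J₁∖J'} p, M − p_{J₂})`. -/
theorem stmt12 {ι : Type*} [Fintype ι] [DecidableEq ι]
    (p c : ι → ℕ) (hc : ∀ i, c i = 1 ∨ c i = 2) (M : ℕ)
    (hfit : ∀ i, p i ≤ M)
    (hpJ2 : pJ2 p c < M)
    (J' : Finset ι) (hJ' : J' ⊆ J1set c) :
    ∃ x : ι → ℕ, (∀ i, x i + p i ≤ M) ∧
      2 * pJ2 p c + min (∑ i ∈ J', p i) (M - pJ2 p c)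
        + min (∑ i ∈ J1set c \ J', p i) (M - pJ2 p c)
      ≤ lev2F p c M x := by
  obtain ⟨x0, h0, c0⟩ := cover_aux p M 0 hfit (J2set c)
  obtain ⟨x1, h1, c1⟩ := cover_aux p M (pJ2 p c) hfit J'
  obtain ⟨x2, h2, c2⟩ := cover_aux p M (pJ2 p c) hfit (J1set c \ J')
  have e0 : ∑ i ∈ J2set c, p i = pJ2 p c := rfl
  rw [e0] at c0
  set P := pJ2 p c with hP
  set A := ∑ i ∈ J', p i with hA
  set B := ∑ i ∈ J1set c \ J', p i with hB
  refine ⟨fun i => if c i = 2 then x0 i else if i ∈ J' then x1 i else x2 i, ?_, ?_⟩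
  · intro i
    have := h0 i
    have := h1 i
    have := h2 i
    dsimp only
    split_ifs <;> assumption
  have s0 := sum_ind_aux M 0 P 2 (by omega)
  have s1 := sum_ind_aux M P (min A (M - P)) 1 (by omega)
  have s2 := sum_ind_aux M P (min B (M - P)) 1 (by omega)
  rw [mul_one] at s1 s2
  rw [mul_comm 2 P, ← s0, ← s1, ← s2, ← Finset.sum_add_distrib, ← Finset.sum_add_distrib]
  unfold lev2F
  apply Finset.sum_le_sum
  intro τ hτ
  rw [Finset.mem_range] at hτ
  set x : ι → ℕ := fun i => if c i = 2 then x0 i else if i ∈ J' then x1 i else x2 i with hx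
  set R := univ.filter (fun i => x i ≤ τ ∧ τ < x i + p i) with hR
  have hc1 : ∀ i, i ∈ J1set c → c i = 1 := fun i hi => by simpa [J1set] using hi
  have k0 : τ < P → 2 ≤ ∑ i ∈ R, c i := by
    intro h
    obtain ⟨i, hi, hh⟩ := c0 τ (Nat.zero_le _) hτ (by omega)
    have hi2 : c i = 2 := by simpa [J2set] using hi
    have hiR : i ∈ R := by simpa [hR, hx, hi2] using hh
    calc 2 = c i := hi2.symm
      _ ≤ _ := Finset.single_le_sum (f := c) (fun _ _ => Nat.zero_le _) hiR
  have k1 : P ≤ τ → τ < P + A → ∃ i ∈ R, i ∈ J' := by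
    intro h h'
    obtain ⟨i, hi, hh⟩ := c1 τ h hτ h'
    have hi1 := hc1 i (hJ' hi)
    exact ⟨i, by simpa [hR, hx, hi1, hi] using hh, hi⟩
  have k2 : P ≤ τ → τ < P + B → ∃ i ∈ R, i ∉ J' := by
    intro h h'
    obtain ⟨i, hi, hh⟩ := c2 τ h hτ h'
    rw [Finset.mem_sdiff] at hi
    have hi1 := hc1 i hi.1
    exact ⟨i, by simpa [hR, hx, hi1, hi.2] using hh, hi.2⟩
  have hpos : ∀ i, 1 ≤ c i := fun i => by rcases hc i with h | h <;> omega
  have one : ∀ i ∈ R, 1 ≤ ∑ i ∈ R, c i := fun i hi =>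
    (hpos i).trans (Finset.single_le_sum (f := c) (fun _ _ => Nat.zero_le _) hi)
  have m1 : P ≤ τ → τ < P + A → 1 ≤ ∑ i ∈ R, c i := fun h h' => by
    obtain ⟨i, hi, _⟩ := k1 h h'
    exact one i hi
  have m2 : P ≤ τ → τ < P + B → 1 ≤ ∑ i ∈ R, c i := fun h h' => by
    obtain ⟨i, hi, _⟩ := k2 h h'
    exact one i hi
  have m3 : P ≤ τ → τ < P + A → τ < P + B → 2 ≤ ∑ i ∈ R, c i := fun h h' h'' => by
    obtain ⟨i, hi, hi'⟩ := k1 h h'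
    obtain ⟨j, hj, hj'⟩ := k2 h h''
    have hij : i ≠ j := fun e => hj' (e ▸ hi')
    have hsub : ({i, j} : Finset ι) ⊆ R := by
      intro t ht
      rcases Finset.mem_insert.1 ht with rfl | ht
      · exact hi
      · rw [Finset.mem_singleton.1 ht]
        exact hj
    have := Finset.sum_le_sum_of_subset (f := c) hsub
    rw [Finset.sum_pair hij] at this
    have := hpos i
    have := hpos j
    omega
  generalize ∑ i ∈ R, c i = r at *
  clear_value P A B
  clear s0 s1 s2
  split_ifs <;> omega
end

section
/- For L2 | C_{max} ≤ M | F with no precedence constraints, consumptions in {1,2}, and p_{J_2} < M, the optimum satisfies max_x F(x) = 2·p_{J_2} + max_{J' ⊆ J_1} [ min(Σ_{i∈J'} p_i, M − p_{J_2}) + min(Σ_{i∈J_1∖J'} p_i, M − p_{J_2}) ]. -/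
open Finset

variable {ι : Type*}

/-- Two-colouring of a finite family of intervals such that every point covered at least twice
sees both colours. -/
theorem color_aux {ι : Type*} [DecidableEq ι] (p x : ι → ℕ) (S : Finset ι) :
    ∃ A B : Finset ι, A ∪ B = S ∧ Disjoint A B ∧ ∀ τ, ∀ i ∈ S, ∀ j ∈ S, i ≠ j →
      (x i ≤ τ ∧ τ < x i + p i) → (x j ≤ τ ∧ τ < x j + p j) →
      (∃ k ∈ A, x k ≤ τ ∧ τ < x k + p k) ∧ (∃ k ∈ B, x k ≤ τ ∧ τ < x k + p k) := by
  induction S using Finset.induction_on_max_value x with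
  | empty => exact ⟨∅, ∅, by simp⟩
  | insert a s ha hmax ih =>
    obtain ⟨A, B, hAB, hd, h⟩ := ih
    -- put `a` into the colour with the smaller farthest end
    have key : ∀ A B : Finset ι, A ∪ B = s → Disjoint A B →
        (∀ τ, ∀ i ∈ s, ∀ j ∈ s, i ≠ j →
          (x i ≤ τ ∧ τ < x i + p i) → (x j ≤ τ ∧ τ < x j + p j) →
          (∃ k ∈ A, x k ≤ τ ∧ τ < x k + p k) ∧ (∃ k ∈ B, x k ≤ τ ∧ τ < x k + p k)) →
        A.sup (fun k => x k + p k) ≤ B.sup (fun k => x k + p k) →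
        ∀ τ, ∀ i ∈ insert a s, ∀ j ∈ insert a s, i ≠ j →
          (x i ≤ τ ∧ τ < x i + p i) → (x j ≤ τ ∧ τ < x j + p j) →
          (∃ k ∈ insert a A, x k ≤ τ ∧ τ < x k + p k) ∧
            (∃ k ∈ B, x k ≤ τ ∧ τ < x k + p k) := by
      intro A B hAB hd h hle τ i hi j hj hij hci hcj
      have main : ∀ j ∈ s, (x a ≤ τ ∧ τ < x a + p a) → (x j ≤ τ ∧ τ < x j + p j) →
          (∃ k ∈ insert a A, x k ≤ τ ∧ τ < x k + p k) ∧
            (∃ k ∈ B, x k ≤ τ ∧ τ < x k + p k) := by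
        intro j hj hca hcj
        refine ⟨⟨a, mem_insert_self _ _, hca⟩, ?_⟩
        have hlt : τ < B.sup (fun k => x k + p k) := by
          rw [← hAB, mem_union] at hj
          rcases hj with hj | hj
          · have := Finset.le_sup (f := fun k => x k + p k) hj
            omega
          · have := Finset.le_sup (f := fun k => x k + p k) hj
            omega
        obtain ⟨k, hk, hk2⟩ := (Finset.lt_sup_iff).1 hlt
        refine ⟨k, hk, ?_, hk2⟩
        have := hmax k (by rw [← hAB]; exact mem_union_right _ hk)
        omega
      rcases mem_insert.1 hi with rfl | hi'
      · rcases mem_insert.1 hj with rfl | hj'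
        · exact absurd rfl hij
        · exact main j hj' hci hcj
      · rcases mem_insert.1 hj with rfl | hj'
        · exact main i hi' hcj hci
        · obtain ⟨⟨k, hk, hk2⟩, h2⟩ := h τ i hi' j hj' hij hci hcj
          exact ⟨⟨k, mem_insert_of_mem hk, hk2⟩, h2⟩
    have haA : a ∉ A := fun h => ha (by rw [← hAB]; exact mem_union_left _ h)
    have haB : a ∉ B := fun h => ha (by rw [← hAB]; exact mem_union_right _ h)
    rcases le_total (A.sup (fun k => x k + p k)) (B.sup (fun k => x k + p k)) with hle | hle
    · refine ⟨insert a A, B, by rw [insert_union, hAB], ?_, key A B hAB hd h hle⟩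
      rw [disjoint_insert_left]
      exact ⟨haB, hd⟩
    · refine ⟨A, insert a B, by rw [union_insert, hAB], ?_, ?_⟩
      · rw [disjoint_insert_right]
        exact ⟨haA, hd⟩
      · intro τ i hi j hj hij hci hcj
        exact (key B A (by rw [union_comm, hAB]) hd.symm
          (fun τ i hi j hj hij hci hcj => (h τ i hi j hj hij hci hcj).symm) hle
          τ i hi j hj hij hci hcj).symm

/-- Sequential placement of the jobs of `S` from time `P` on, pushed back at the deadline. -/
theorem place_aux {ι : Type*} [DecidableEq ι] (p : ι → ℕ) (M P : ℕ)
    (hfit : ∀ i, p i ≤ M) (S : Finset ι) :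
    ∃ x : ι → ℕ, (∀ i, x i + p i ≤ M) ∧ ∀ τ, P ≤ τ → τ < M → τ < P + ∑ i ∈ S, p i →
      ∃ i ∈ S, x i ≤ τ ∧ τ < x i + p i := by
  induction S using Finset.induction_on with
  | empty =>
    refine ⟨fun _ => 0, by simpa using hfit, ?_⟩
    intro τ h1 _ h3
    simp at h3
    omega
  | insert a s ha ih =>
    obtain ⟨x, hx, h⟩ := ih
    refine ⟨Function.update x a (min (P + ∑ i ∈ s, p i) (M - p a)), ?_, ?_⟩
    · intro i
      by_cases hi : i = a
      · subst hi
        have := hfit i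
        simp only [Function.update_self]
        omega
      · simpa [Function.update_of_ne hi] using hx i
    · intro τ h1 h2 h3
      rw [sum_insert ha] at h3
      by_cases hτ : τ < P + ∑ i ∈ s, p i
      · obtain ⟨i, hi, hc⟩ := h τ h1 h2 hτ
        have hne : i ≠ a := fun e => ha (e ▸ hi)
        exact ⟨i, mem_insert_of_mem hi, by simpa [Function.update_of_ne hne] using hc⟩
      · refine ⟨a, mem_insert_self _ _, ?_⟩
        have := hfit a
        simp only [Function.update_self]
        omega

theorem cover_card_aux {ι : Type*} [DecidableEq ι] (p x : ι → ℕ) (M : ℕ) (S : Finset ι) :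
    ((range M).filter (fun τ => ∃ i ∈ S, x i ≤ τ ∧ τ < x i + p i)).card ≤ ∑ i ∈ S, p i := by
  calc _ ≤ (S.biUnion (fun i => Finset.Ico (x i) (x i + p i))).card := by
        apply card_le_card
        intro τ hτ
        simp only [mem_filter] at hτ
        simpa using hτ.2
    _ ≤ ∑ i ∈ S, (Finset.Ico (x i) (x i + p i)).card := card_biUnion_le
    _ = _ := by simp

theorem upper_aux {ι : Type*} [Fintype ι] [DecidableEq ι]
    (p c : ι → ℕ) (hc : ∀ i, c i = 1 ∨ c i = 2) (M : ℕ)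
    (hpJ2 : pJ2 p c < M) (x : ι → ℕ) :
    ∃ A ∈ (J1set c).powerset, lev2F p c M x ≤ 2 * pJ2 p c + (min (∑ i ∈ A, p i) (M - pJ2 p c)
          + min (∑ i ∈ J1set c \ A, p i) (M - pJ2 p c)) := by
  obtain ⟨A, B, hAB, hd, h⟩ := color_aux p x (J1set c)
  have hB : J1set c \ A = B := by
    rw [← hAB, union_sdiff_left]
    exact sdiff_eq_self_of_disjoint hd.symm
  refine ⟨A, by rw [mem_powerset, ← hAB]; exact subset_union_left, ?_⟩
  rw [hB]
  set U := (range M).filter (fun τ => ∃ i ∈ J2set c, x i ≤ τ ∧ τ < x i + p i) with hU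
  set CA := (range M).filter (fun τ => ∃ i ∈ A, x i ≤ τ ∧ τ < x i + p i) with hCA
  set CB := (range M).filter (fun τ => ∃ i ∈ B, x i ≤ τ ∧ τ < x i + p i) with hCB
  have cU : U.card ≤ pJ2 p c := cover_card_aux p x M _
  have cA : CA.card ≤ ∑ i ∈ A, p i := cover_card_aux p x M _
  have cB : CB.card ≤ ∑ i ∈ B, p i := cover_card_aux p x M _
  have hUs : U ⊆ range M := filter_subset _ _
  have cMU : (range M \ U).card = M - U.card := by
    rw [card_sdiff_of_subset hUs, card_range]
  have cA1 : (CA \ U).card ≤ CA.card := card_le_card sdiff_subset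
  have cB1 : (CB \ U).card ≤ CB.card := card_le_card sdiff_subset
  have cA2 : (CA \ U).card ≤ M - U.card := by
    rw [← cMU]; exact card_le_card (sdiff_subset_sdiff (filter_subset _ _) (le_refl _))
  have cB2 : (CB \ U).card ≤ M - U.card := by
    rw [← cMU]; exact card_le_card (sdiff_subset_sdiff (filter_subset _ _) (le_refl _))
  have hF : lev2F p c M x ≤ 2 * U.card + ((CA \ U).card + (CB \ U).card) := by
    have e : ∀ T : Finset ℕ, T ⊆ range M →
        T.card = ∑ τ ∈ range M, if τ ∈ T then 1 else 0 := by
      intro T hT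
      rw [sum_ite_mem, inter_eq_right.2 hT]
      simp
    rw [e U hUs, e (CA \ U) (sdiff_subset.trans (filter_subset _ _)),
      e (CB \ U) (sdiff_subset.trans (filter_subset _ _)), mul_sum, ← sum_add_distrib,
      ← sum_add_distrib]
    unfold lev2F
    apply sum_le_sum
    intro τ hτ
    by_cases hτU : τ ∈ U
    · simp [hτU]
    · simp only [hτU, mem_sdiff, not_false_eq_true, and_true, if_false, mul_zero, zero_add]
      have hmem : ∀ i, (x i ≤ τ ∧ τ < x i + p i) → i ∈ J1set c := by
        intro i hi
        rcases hc i with h1 | h2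
        · simp [J1set, h1]
        · exact absurd (mem_filter.2 ⟨hτ, i, by simp [J2set, h2], hi⟩) hτU
      have hsum : ∑ i ∈ univ.filter (fun i => x i ≤ τ ∧ τ < x i + p i), c i
          = (univ.filter (fun i => x i ≤ τ ∧ τ < x i + p i)).card := by
        rw [card_eq_sum_ones]
        apply sum_congr rfl
        intro i hi
        have := hmem i (mem_filter.1 hi).2
        exact (mem_filter.1 this).2
      rw [hsum]
      set T := univ.filter (fun i => x i ≤ τ ∧ τ < x i + p i) with hT
      rcases Nat.lt_or_ge 1 T.card with h1 | h1
      · obtain ⟨i, hi, j, hj, hij⟩ := one_lt_card.1 h1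
        have hi' := (mem_filter.1 hi).2
        have hj' := (mem_filter.1 hj).2
        obtain ⟨ha, hb⟩ := h τ i (hmem i hi') j (hmem j hj') hij hi' hj'
        have ha' : τ ∈ CA := mem_filter.2 ⟨hτ, ha⟩
        have hb' : τ ∈ CB := mem_filter.2 ⟨hτ, hb⟩
        simp [ha', hb']
      · rcases Nat.eq_zero_or_pos T.card with h0 | h0
        · simp [h0]
        · obtain ⟨i, hi⟩ := card_pos.1 h0
          have hi' := (mem_filter.1 hi).2
          have hm := hmem i hi'
          rw [← hAB, mem_union] at hm
          refine (min_le_right _ _).trans (h1.trans ?_)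
          rcases hm with hm | hm
          · have ha' : τ ∈ CA := mem_filter.2 ⟨hτ, i, hm, hi'⟩
            simp [ha']
          · have ha' : τ ∈ CB := mem_filter.2 ⟨hτ, i, hm, hi'⟩
            simp [ha']
  omega

theorem lower_aux {ι : Type*} [Fintype ι] [DecidableEq ι]
    (p c : ι → ℕ) (M : ℕ)
    (hfit : ∀ i, p i ≤ M)
    (hpJ2 : pJ2 p c < M) (A : Finset ι) (hA : A ⊆ J1set c) :
    ∃ x : ι → ℕ, (∀ i, x i + p i ≤ M) ∧
      2 * pJ2 p c + (min (∑ i ∈ A, p i) (M - pJ2 p c)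
          + min (∑ i ∈ J1set c \ A, p i) (M - pJ2 p c)) ≤ lev2F p c M x := by
  obtain ⟨x2, hx2, h2⟩ := place_aux p M 0 hfit (J2set c)
  obtain ⟨xa, hxa, ha⟩ := place_aux p M (pJ2 p c) hfit A
  obtain ⟨xb, hxb, hb⟩ := place_aux p M (pJ2 p c) hfit (J1set c \ A)
  have hsum2 : ∑ i ∈ J2set c, p i = pJ2 p c := rfl
  rw [hsum2] at h2
  set P := pJ2 p c with hP
  set a := ∑ i ∈ A, p i with haa
  set b := ∑ i ∈ J1set c \ A, p i with hbb
  let x : ι → ℕ := fun i => if c i = 2 then x2 i else if i ∈ A then xa i else xb i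
  have xe2 : ∀ i ∈ J2set c, x i = x2 i := by
    intro i hi
    simp [x, (mem_filter.1 hi).2]
  have xea : ∀ i ∈ A, x i = xa i ∧ c i = 1 := by
    intro i hi
    have := (mem_filter.1 (hA hi)).2
    simp [x, this, hi]
  have xeb : ∀ i ∈ J1set c \ A, x i = xb i ∧ c i = 1 := by
    intro i hi
    have h1 := (mem_filter.1 (mem_sdiff.1 hi).1).2
    simp [x, h1, (mem_sdiff.1 hi).2]
  refine ⟨x, ?_, ?_⟩
  · intro i
    simp only [x]
    split_ifs
    exacts [hx2 i, hxa i, hxb i]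
  · have e : ∀ T : Finset ℕ, T ⊆ range M →
        T.card = ∑ τ ∈ range M, if τ ∈ T then 1 else 0 := by
      intro T hT
      rw [sum_ite_mem, inter_eq_right.2 hT]
      simp
    have sub : ∀ u v, v ≤ M → Finset.Ico u v ⊆ range M := by
      intro u v hv τ hτ
      simp only [Finset.mem_Ico, mem_range] at *
      omega
    have e1 : P = (Finset.Ico 0 P).card := by simp
    have e2 : min a (M - P) = (Finset.Ico P (min M (P + a))).card := by
      rw [Nat.card_Ico]; omega
    have e3 : min b (M - P) = (Finset.Ico P (min M (P + b))).card := by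
      rw [Nat.card_Ico]; omega
    have step : 2 * P = 2 * (Finset.Ico 0 P).card := by rw [← e1]
    rw [step, e2, e3, e _ (sub _ _ hpJ2.le), e _ (sub _ _ (min_le_left _ _)),
      e _ (sub _ _ (min_le_left _ _)), mul_sum, ← sum_add_distrib, ← sum_add_distrib]
    unfold lev2F
    apply sum_le_sum
    intro τ hτ
    rw [mem_range] at hτ
    simp only [Finset.mem_Ico]
    by_cases hτP : τ < P
    · obtain ⟨i, hi, hci⟩ := h2 τ (Nat.zero_le _) hτ (by omega)
      rw [← xe2 i hi] at hci
      have hle := single_le_sum (f := c)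
            (s := univ.filter (fun k => x k ≤ τ ∧ τ < x k + p k)) (fun _ _ => Nat.zero_le _)
        (mem_filter.2 ⟨mem_univ i, hci⟩)
      rw [(mem_filter.1 hi).2] at hle
      have hn : ¬ P ≤ τ := by omega
      simp [hτP, hn, hle]
    · have hPτ : P ≤ τ := by omega
      by_cases h_a : τ < P + a
      · obtain ⟨i, hi, hci⟩ := ha τ hPτ hτ h_a
        rw [← (xea i hi).1] at hci
        by_cases h_b : τ < P + b
        · obtain ⟨j, hj, hcj⟩ := hb τ hPτ hτ h_b
          rw [← (xeb j hj).1] at hcj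
          have hij : i ≠ j := fun e => (mem_sdiff.1 hj).2 (e ▸ hi)
          have hle : ∑ k ∈ {i, j}, c k
              ≤ ∑ k ∈ univ.filter (fun k => x k ≤ τ ∧ τ < x k + p k), c k := by
            apply sum_le_sum_of_subset
            intro k hk
            rcases mem_insert.1 hk with rfl | hk
            · exact mem_filter.2 ⟨mem_univ _, hci⟩
            · rw [mem_singleton.1 hk]
              exact mem_filter.2 ⟨mem_univ _, hcj⟩
          rw [sum_pair hij, (xea i hi).2, (xeb j hj).2] at hle
          split_ifs <;> omega
        · have hle := single_le_sum (f := c)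
            (s := univ.filter (fun k => x k ≤ τ ∧ τ < x k + p k)) (fun _ _ => Nat.zero_le _)
            (mem_filter.2 ⟨mem_univ i, hci⟩)
          rw [(xea i hi).2] at hle
          split_ifs <;> omega
      · by_cases h_b : τ < P + b
        · obtain ⟨j, hj, hcj⟩ := hb τ hPτ hτ h_b
          rw [← (xeb j hj).1] at hcj
          have hle := single_le_sum (f := c)
            (s := univ.filter (fun k => x k ≤ τ ∧ τ < x k + p k)) (fun _ _ => Nat.zero_le _)
            (mem_filter.2 ⟨mem_univ j, hcj⟩)
          rw [(xeb j hj).2] at hle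
          split_ifs <;> omega
        · split_ifs <;> omega

/-- The optimum of `L2 | C_max ≤ M | F` equals
`2·p_{J₂} + max_{J' ⊆ J₁} [min(Σ_{J'} p, M − p_{J₂}) + min(Σ_{J₁∖J'} p, M − p_{J₂})]`. -/
theorem stmt14 {ι : Type*} [Fintype ι] [DecidableEq ι]
    (p c : ι → ℕ) (hc : ∀ i, c i = 1 ∨ c i = 2) (M : ℕ)
    (hfit : ∀ i, p i ≤ M)
    (hpJ2 : pJ2 p c < M) :
    IsGreatest {v : ℕ | ∃ x : ι → ℕ, (∀ i, x i + p i ≤ M) ∧ lev2F p c M x = v}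
      (2 * pJ2 p c + (J1set c).powerset.sup (fun J' =>
        min (∑ i ∈ J', p i) (M - pJ2 p c)
          + min (∑ i ∈ J1set c \ J', p i) (M - pJ2 p c))) := by
  have hup : ∀ x : ι → ℕ, lev2F p c M x ≤ 2 * pJ2 p c + (J1set c).powerset.sup (fun J' =>
        min (∑ i ∈ J', p i) (M - pJ2 p c)
          + min (∑ i ∈ J1set c \ J', p i) (M - pJ2 p c)) := by
    intro x
    obtain ⟨A, hA, h⟩ := upper_aux p c hc M hpJ2 x
    exact h.trans (Nat.add_le_add_left (Finset.le_sup (f := fun J' =>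
        min (∑ i ∈ J', p i) (M - pJ2 p c)
          + min (∑ i ∈ J1set c \ J', p i) (M - pJ2 p c)) hA) _)
  constructor
  · obtain ⟨A, hA, h⟩ := Finset.exists_mem_eq_sup (J1set c).powerset
      ⟨∅, empty_mem_powerset _⟩ (fun J' =>
        min (∑ i ∈ J', p i) (M - pJ2 p c)
          + min (∑ i ∈ J1set c \ J', p i) (M - pJ2 p c))
    obtain ⟨x, hx, hle⟩ := lower_aux p c M hfit hpJ2 A (mem_powerset.1 hA)
    refine ⟨x, hx, le_antisymm (hup x) ?_⟩
    rw [h]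
    exact hle
  · rintro v ⟨x, _, rfl⟩
    exact hup x
end
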